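/- Let K be a field of characteristic different from 2, m ∈ ℕ, π and ρ nondegenerate quadratic forms over K with dim(π) < 2^{m+1} and ρ belonging to I^{m+1}K (the (m+1)-st power of the fundamental ideal of the Witt ring). Then G(π ⊥ ρ) = G(π) ∩ G(ρ). -/

import Mathlib

open scoped TensorProduct

/-- A (finite-dimensional) quadratic form over the field `K`, bundled with its
underlying vector space. -/
structure QF (K : Type) [Field K] where
  V : Type
  [iAG : AddCommGroup V]
  [iM : Module K V]
  [iFD : FiniteDimensional K V]
  q : QuadraticForm K V

namespace QF

variable {K : Type} [Field K]

instance (φ : QF K) : AddCommGroup φ.V := φ.iAG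
instance (φ : QF K) : Module K φ.V := φ.iM
instance (φ : QF K) : FiniteDimensional K φ.V := φ.iFD

/-- dimension of a quadratic form -/
noncomputable def dim (φ : QF K) : ℕ := Module.finrank K φ.V

/-- isometry of quadratic forms -/
def Equiv (φ ψ : QF K) : Prop := QuadraticMap.Equivalent φ.q ψ.q

/-- nondegeneracy of a quadratic form (via its polar bilinear form) -/
def Nondeg (φ : QF K) : Prop := (QuadraticMap.polarBilin φ.q).Nondegenerate

/-- scaling a quadratic form by a scalar -/
def smul (a : K) (φ : QF K) : QF K := { V := φ.V, q := a • φ.q }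

/-- orthogonal sum of quadratic forms -/
def add (φ ψ : QF K) : QF K := { V := φ.V × ψ.V, q := φ.q.prod ψ.q }

/-- the zero-dimensional quadratic form -/
noncomputable def zero : QF K := { V := Fin 0 → K, q := QuadraticMap.weightedSumSquares K (fun i : Fin 0 => (1 : K)) }

/-- the form `⟨1⟩` -/
noncomputable def one : QF K := { V := Fin 1 → K, q := QuadraticMap.weightedSumSquares K (fun _ : Fin 1 => (1 : K)) }

/-- the binary form `⟨1, -a⟩ = ⟪a⟫` -/
noncomputable def bin (a : K) : QF K :=
  { V := Fin 2 → K, q := QuadraticMap.weightedSumSquares K ![(1 : K), -a] }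

/-- tensor product of quadratic forms -/
noncomputable def tmul [Invertible (2 : K)] (φ ψ : QF K) : QF K :=
  { V := φ.V ⊗[K] ψ.V, q := QuadraticForm.tmul φ.q ψ.q }

/-- `m` copies of the hyperbolic plane `⟨1, -1⟩` -/
noncomputable def hyperbolics : ℕ → QF K
  | 0 => zero
  | m + 1 => add (bin 1) (hyperbolics m)

/-- a form is hyperbolic if it is isometric to a sum of hyperbolic planes -/
def IsHyperbolic (φ : QF K) : Prop := ∃ m : ℕ, φ.Equiv (hyperbolics m)

/-- anisotropy -/
def Anisotropic (φ : QF K) : Prop := φ.q.Anisotropic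

/-- the Witt index -/
noncomputable def wittIndex (φ : QF K) : ℕ :=
  sSup {m : ℕ | ∃ ψ : QF K, φ.Equiv (add (hyperbolics m) ψ)}

/-- a form is split if its anisotropic part has dimension at most one -/
def IsSplit (φ : QF K) : Prop :=
  ∃ (m : ℕ) (ψ : QF K), ψ.Anisotropic ∧ ψ.dim ≤ 1 ∧ φ.Equiv (add (hyperbolics m) ψ)

/-- `n`-fold orthogonal sum of a fixed form -/
noncomputable def nsmul : ℕ → QF K → QF K
  | 0, _ => zero
  | n + 1, φ => add φ (nsmul n φ)

/-- orthogonal sum of a list of forms -/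
noncomputable def sumList : List (QF K) → QF K
  | [] => zero
  | φ :: l => add φ (sumList l)

/-- the Pfister form `⟨⟨a₁, …, aₙ⟩⟩` -/
noncomputable def pfister [Invertible (2 : K)] : List K → QF K
  | [] => one
  | a :: l => tmul (bin a) (pfister l)

/-- Witt equivalence of quadratic forms -/
def WittEquiv (φ ψ : QF K) : Prop := IsHyperbolic (add φ (smul (-1) ψ))

/-- membership in the `n`-th power of the fundamental ideal: Witt equivalence
to an orthogonal sum of scaled `n`-fold Pfister forms -/
def InFundPow [Invertible (2 : K)] (n : ℕ) (φ : QF K) : Prop :=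
  ∃ (r : ℕ) (c : Fin r → K) (l : Fin r → (Fin n → K)),
    (∀ i, c i ≠ 0) ∧
    WittEquiv φ (sumList ((List.finRange r).map fun i => smul (c i) (pfister (List.ofFn (l i)))))

/-- the group of similarity factors `G(φ) = {a ∈ K× : aφ ≅ φ}`, as a set -/
def G (φ : QF K) : Set K := {a | a ≠ 0 ∧ (smul a φ).Equiv φ}

/-- similarity factors of a family of forms -/
def GT {r : ℕ} (φ : Fin r → QF K) : Set K := ⋂ i, G (φ i)

end QF

/-- a bundled field extension of `K` -/
structure FieldExt (K : Type) [Field K] where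
  carrier : Type
  [iF : Field carrier]
  [iA : Algebra K carrier]

attribute [instance] FieldExt.iF FieldExt.iA

namespace QF

variable {K : Type} [Field K]

/-- base change of a quadratic form along a field extension -/
noncomputable def baseChange [Invertible (2 : K)] (L : Type) [Field L] [Algebra K L]
    (φ : QF K) : QF L :=
  { V := L ⊗[K] φ.V, q := QuadraticForm.baseChange L φ.q }

end QF

/-- the set of nonzero norms of a finite field extension -/
def normSet (K : Type) [Field K] (L : Type) [Field L] [Algebra K L] : Set K :=
  {a | ∃ x : L, x ≠ 0 ∧ Algebra.norm K x = a}

/-- a finite `2`-extension: a tower of quadratic extensions -/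
def IsTwoExtension (K : Type) [Field K] (L : Type) [Field L] [Algebra K L] : Prop :=
  FiniteDimensional K L ∧
    ∃ (n : ℕ) (F : Fin (n + 1) → IntermediateField K L),
      F 0 = ⊥ ∧ F (Fin.last n) = ⊤ ∧
        ∀ i : Fin n, F i.castSucc ≤ F i.succ ∧
          IntermediateField.relfinrank (F i.castSucc) (F i.succ) = 2

/-- a multiquadratic extension: Galois with elementary abelian 2-group -/
def IsMultiquadratic (K : Type) [Field K] (L : Type) [Field L] [Algebra K L] : Prop :=
  FiniteDimensional K L ∧ IsGalois K L ∧ ∀ σ : L ≃ₐ[K] L, σ * σ = 1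

namespace QF

variable {K : Type} [Field K] [Invertible (2 : K)]

/-- generating set for `Hyp(φ)`: norms from finite extensions splitting `φ` -/
def hypSet (φ : QF K) : Set K :=
  {a | ∃ L : FieldExt K, FiniteDimensional K L.carrier ∧
    IsHyperbolic (baseChange L.carrier φ) ∧ a ∈ normSet K L.carrier}

/-- the subgroup `Hyp(φ)` generated by norms of finite extensions splitting `φ` -/
def Hyp (φ : QF K) : Submonoid K := Submonoid.closure (hypSet φ)

/-- generating set for `Hyp₂(φ)`: norms from finite 2-extensions splitting `φ` -/
def hypSet2 (φ : QF K) : Set K :=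
  {a | ∃ L : FieldExt K, IsTwoExtension K L.carrier ∧
    IsHyperbolic (baseChange L.carrier φ) ∧ a ∈ normSet K L.carrier}

/-- the subgroup `Hyp₂(φ)` -/
def Hyp2 (φ : QF K) : Submonoid K := Submonoid.closure (hypSet2 φ)

/-- `H(φ) = K×² · Hyp(φ)` -/
def Hgrp (φ : QF K) : Set K :=
  {x | ∃ s : K, s ≠ 0 ∧ ∃ h ∈ Hyp φ, x = s ^ 2 * h}

/-- `K×² · Hyp₂(φ)` -/
def H2grp (φ : QF K) : Set K :=
  {x | ∃ s : K, s ≠ 0 ∧ ∃ h ∈ Hyp2 φ, x = s ^ 2 * h}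

/-- the splitting pattern: the set of Witt indices over all field extensions -/
def Sp (φ : QF K) : Set ℕ :=
  {m | ∃ L : FieldExt K, m = wittIndex (baseChange L.carrier φ)}

end QF

namespace QF

variable {K : Type} [Field K] [Invertible (2 : K)]

/-- norms from finite extensions splitting all forms in a family -/
def hypSetT {r : ℕ} (φ : Fin r → QF K) : Set K :=
  {a | ∃ L : FieldExt K, FiniteDimensional K L.carrier ∧
    (∀ i, IsHyperbolic (baseChange L.carrier (φ i))) ∧ a ∈ normSet K L.carrier}

/-- the subgroup `Hyp` of a family of forms -/
def HypT {r : ℕ} (φ : Fin r → QF K) : Submonoid K := Submonoid.closure (hypSetT φ)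

/-- norms from finite 2-extensions splitting all forms in a family -/
def hypSet2T {r : ℕ} (φ : Fin r → QF K) : Set K :=
  {a | ∃ L : FieldExt K, IsTwoExtension K L.carrier ∧
    (∀ i, IsHyperbolic (baseChange L.carrier (φ i))) ∧ a ∈ normSet K L.carrier}

/-- the subgroup `Hyp₂` of a family of forms -/
def Hyp2T {r : ℕ} (φ : Fin r → QF K) : Submonoid K := Submonoid.closure (hypSet2T φ)

/-- `H` of a family of forms: `K×² · Hyp` -/
def HgrpT {r : ℕ} (φ : Fin r → QF K) : Set K :=
  {x | ∃ s : K, s ≠ 0 ∧ ∃ h ∈ HypT φ, x = s ^ 2 * h}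

end QF

/-- the map `O → O'` between valuation rings induced by a compatible field embedding -/
def liftVSHom {K M : Type} [Field K] [Field M] [Algebra K M]
    (O : ValuationSubring K) (OM : ValuationSubring M)
    (hc : ∀ x : K, x ∈ O ↔ algebraMap K M x ∈ OM) : O →+* OM where
  toFun x := ⟨algebraMap K M x, (hc x).1 x.2⟩
  map_one' := by ext; simp
  map_mul' x y := by ext; simp
  map_zero' := by ext; simp
  map_add' x y := by ext; simp

/-- `v` is unramified in the subextension `E` of `M/K`: the value group does not grow
and the residue field extension is separable (every residue is a simple root of a
separable polynomial over the residue field of `O`) -/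
def UnramifiedIn {K M : Type} [Field K] [Field M] [Algebra K M]
    (O : ValuationSubring K) (OM : ValuationSubring M)
    (hc : ∀ x : K, x ∈ O ↔ algebraMap K M x ∈ OM) (E : IntermediateField K M) : Prop :=
  (∀ y : M, y ∈ E → y ≠ 0 →
      ∃ x : K, x ≠ 0 ∧ OM.valuation y = OM.valuation (algebraMap K M x)) ∧
  (∀ y : M, y ∈ E → ∀ hy : y ∈ OM, ∃ p : Polynomial O, p.Monic ∧
      (p.map (IsLocalRing.residue O)).Separable ∧
      Polynomial.eval (⟨y, hy⟩ : OM) (p.map (liftVSHom O OM hc)) ∈ IsLocalRing.maximalIdeal OM)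

/-- the value group of a valuation, as a subgroup of the units of the codomain -/
def unitsValueGroup {L Γ : Type} [Field L] [LinearOrderedCommGroupWithZero Γ]
    (w : Valuation L Γ) : Subgroup Γˣ :=
  (Units.map w.toMonoidWithZeroHom.toMonoidHom).range

/-- iterated Laurent series field, bundled with its field structure -/
noncomputable def IterLaurentP (k : Type) [Field k] : ℕ → Σ' (T : Type), Field T :=
  fun n => Nat.rec ⟨k, ‹Field k›⟩
    (fun _ p => by letI := p.2; exact ⟨LaurentSeries p.1, inferInstance⟩) n

/-- iterated Laurent series field `k((t₁))…((tₙ))` -/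
@[reducible] noncomputable def IterLaurent (k : Type) [Field k] (n : ℕ) : Type :=
  (IterLaurentP k n).1

noncomputable instance (k : Type) [Field k] (n : ℕ) : Field (IterLaurent k n) :=
  (IterLaurentP k n).2

/-- the embedding of the coefficient field in the iterated Laurent series field -/
noncomputable def iterC (k : Type) [Field k] : ∀ n, k →+* IterLaurent k n
  | 0 => RingHom.id k
  | n + 1 => (HahnSeries.C : IterLaurent k n →+* LaurentSeries (IterLaurent k n)).comp (iterC k n)

/-- the variables `t₁, …, tₙ` of the iterated Laurent series field -/
noncomputable def tvar (k : Type) [Field k] : ∀ n, Fin n → IterLaurent k n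
  | 0 => fun i => i.elim0
  | n + 1 => fun i =>
      (Fin.lastCases (motive := fun _ => LaurentSeries (IterLaurent k n))
        (HahnSeries.single 1 1) (fun j => HahnSeries.C (tvar k n j)) i : IterLaurent k (n + 1))


namespace QF

variable {K : Type} [Field K]

theorem Equiv.rfl' (φ : QF K) : φ.Equiv φ := QuadraticMap.Equivalent.refl _
theorem Equiv.symm' {φ ψ : QF K} (h : φ.Equiv ψ) : ψ.Equiv φ := QuadraticMap.Equivalent.symm h
theorem Equiv.trans' {φ ψ χ : QF K} (h : φ.Equiv ψ) (h' : ψ.Equiv χ) : φ.Equiv χ :=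
  QuadraticMap.Equivalent.trans h h'

theorem Equiv.mk' {φ ψ : QF K} (e : φ.V ≃ₗ[K] ψ.V) (h : ∀ x, ψ.q (e x) = φ.q x) : φ.Equiv ψ :=
  ⟨⟨e, h⟩⟩

theorem Equiv.out {φ ψ : QF K} (h : φ.Equiv ψ) :
    ∃ e : φ.V ≃ₗ[K] ψ.V, ∀ x, ψ.q (e x) = φ.q x := by
  obtain ⟨e⟩ := h
  exact ⟨e.toLinearEquiv, e.map_app'⟩

theorem add_q (φ ψ : QF K) (x : φ.V) (y : ψ.V) : (add φ ψ).q (x, y) = φ.q x + ψ.q y := rfl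
theorem add_q' (φ ψ : QF K) (x : (add φ ψ).V) : (add φ ψ).q x = φ.q x.1 + ψ.q x.2 := rfl
theorem smul_q (a : K) (φ : QF K) (x : φ.V) : (smul a φ).q x = a * φ.q x := rfl

theorem add_congr {φ φ' ψ ψ' : QF K} (h : φ.Equiv φ') (h' : ψ.Equiv ψ') :
    (add φ ψ).Equiv (add φ' ψ') := QuadraticMap.Equivalent.prod h h'

theorem smul_congr (a : K) {φ φ' : QF K} (h : φ.Equiv φ') :
    (smul a φ).Equiv (smul a φ') := by
  obtain ⟨e, he⟩ := h.out
  exact Equiv.mk' (φ := smul a φ) (ψ := smul a φ') e fun x =>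
    congrArg (a * ·) (he x)

theorem smul_add (a : K) (φ ψ : QF K) :
    (smul a (add φ ψ)).Equiv (add (smul a φ) (smul a ψ)) :=
  Equiv.mk' (φ := smul a (add φ ψ)) (ψ := add (smul a φ) (smul a ψ))
    (LinearEquiv.refl K (φ.V × ψ.V)) fun x => (mul_add a (φ.q x.1) (ψ.q x.2)).symm

theorem smul_smul' (a b : K) (φ : QF K) : (smul a (smul b φ)).Equiv (smul (a * b) φ) :=
  Equiv.mk' (φ := smul a (smul b φ)) (ψ := smul (a * b) φ)
    (LinearEquiv.refl K φ.V) fun x => mul_assoc a b (φ.q x)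

theorem add_comm' (φ ψ : QF K) : (add φ ψ).Equiv (add ψ φ) :=
  ⟨QuadraticMap.IsometryEquiv.prodComm _ _⟩

theorem add_assoc' (φ ψ χ : QF K) : (add (add φ ψ) χ).Equiv (add φ (add ψ χ)) :=
  Equiv.mk' (φ := add (add φ ψ) χ) (ψ := add φ (add ψ χ))
    (LinearEquiv.prodAssoc K φ.V ψ.V χ.V) fun x =>
      (add_assoc (φ.q x.1.1) (ψ.q x.1.2) (χ.q x.2)).symm

theorem zero_q0 (x : Fin 0 → K) :
    QuadraticMap.weightedSumSquares K (fun _ : Fin 0 => (1 : K)) x = 0 := by simp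
theorem zero_q (x : (zero : QF K).V) : (zero : QF K).q x = 0 := zero_q0 x

theorem zero_add' (φ : QF K) : (add zero φ).Equiv φ :=
  Equiv.mk' (φ := add zero φ) (ψ := φ)
    (LinearEquiv.uniqueProd (R := K) (M := φ.V) (M₂ := Fin 0 → K)) fun x => by
      rw [add_q']
      have : (zero : QF K).q x.1 = 0 := zero_q _
      rw [this, zero_add]; rfl

/-- rank one form -/
noncomputable def r1 (a : K) : QF K := { V := K, q := a • QuadraticMap.sq }

theorem r1_q (a x : K) : (r1 a).q x = a * (x * x) := rfl

/-- diagonal form attached to a list -/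
noncomputable def dg : List K → QF K
  | [] => zero
  | a :: l => add (r1 a) (dg l)

/-- isometry of diagonal forms -/
def LE (l l' : List K) : Prop := (dg l).Equiv (dg l')

theorem dg_cons_q (a : K) (l : List K) (x : K) (y : (dg l).V) :
    (dg (a :: l)).q (x, y) = a * (x * x) + (dg l).q y := rfl

theorem LE.refl (l : List K) : LE l l := Equiv.rfl' _
theorem LE.symm {l l' : List K} (h : LE l l') : LE l' l := Equiv.symm' h
theorem LE.trans {l l' l'' : List K} (h : LE l l') (h' : LE l' l'') : LE l l'' := Equiv.trans' h h'

theorem dg_append (l l' : List K) : (dg (l ++ l')).Equiv (add (dg l) (dg l')) := by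
  induction l with
  | nil => exact (zero_add' _).symm'
  | cons a l ih =>
    exact (add_congr (Equiv.rfl' _) ih).trans' (add_assoc' _ _ _).symm'

theorem LE.append {l₁ l₂ l₁' l₂' : List K} (h : LE l₁ l₁') (h' : LE l₂ l₂') :
    LE (l₁ ++ l₂) (l₁' ++ l₂') :=
  (dg_append _ _).trans' ((add_congr h h').trans' (dg_append _ _).symm')

theorem LE.cons (a : K) {l l' : List K} (h : LE l l') : LE (a :: l) (a :: l') :=
  add_congr (Equiv.rfl' _) h

theorem LE.perm {l l' : List K} (h : l.Perm l') : LE l l' := by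
  induction h with
  | nil => exact LE.refl _
  | cons a _ ih => exact ih.cons a
  | swap a b l =>
    exact (add_assoc' _ _ _).symm'.trans' ((add_congr (add_comm' _ _) (Equiv.rfl' _)).trans'
      (add_assoc' _ _ _))
  | trans _ _ ih ih' => exact ih.trans ih'

def sc (a : K) (l : List K) : List K := l.map (a * ·)

@[simp] theorem sc_nil (a : K) : sc a [] = [] := rfl
@[simp] theorem sc_cons (a b : K) (l : List K) : sc a (b :: l) = (a * b) :: sc a l := rfl
@[simp] theorem sc_append (a : K) (l l' : List K) : sc a (l ++ l') = sc a l ++ sc a l' := by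
  simp [sc]
@[simp] theorem sc_length (a : K) (l : List K) : (sc a l).length = l.length := by simp [sc]
@[simp] theorem sc_sc (a b : K) (l : List K) : sc a (sc b l) = sc (a * b) l := by
  simp [sc, mul_assoc]
@[simp] theorem sc_one (l : List K) : sc 1 l = l := by simp [sc]
theorem sc_map {L : Type} [Field L] (f : K →+* L) (a : K) (l : List K) :
    (sc a l).map f = sc (f a) (l.map f) := by
  simp [sc]

theorem dg_sc (a : K) (l : List K) : (dg (sc a l)).Equiv (smul a (dg l)) := by
  induction l with
  | nil =>
    refine Equiv.mk' (φ := dg []) (ψ := smul a (dg [])) (LinearEquiv.refl K (Fin 0 → K)) ?_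
    intro x
    have h0 : (dg ([] : List K)).q x = 0 := zero_q x
    exact (congrArg (a * ·) h0).trans ((mul_zero a).trans h0.symm)
  | cons b l ih =>
    refine Equiv.trans' (add_congr ?_ ih) (smul_add a _ _).symm'
    exact Equiv.mk' (φ := r1 (a * b)) (ψ := smul a (r1 b)) (LinearEquiv.refl K K)
      fun (x : K) => (mul_assoc a b (x * x)).symm

theorem LE.sc (a : K) {l l' : List K} (h : LE l l') : LE (sc a l) (sc a l') :=
  (dg_sc _ _).trans' ((smul_congr a h).trans' (dg_sc _ _).symm')

theorem dg_finrank (l : List K) : Module.finrank K (dg l).V = l.length := by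
  induction l with
  | nil => change Module.finrank K (Fin 0 → K) = 0; simp
  | cons a l ih =>
    change Module.finrank K (K × (dg l).V) = _
    rw [Module.finrank_prod, ih]; simp [add_comm]

theorem LE.length {l l' : List K} (h : LE l l') : l.length = l'.length := by
  obtain ⟨e, -⟩ := Equiv.out h
  rw [← dg_finrank l, ← dg_finrank l', e.finrank_eq]

/-- all entries are nonzero -/
def NZ (l : List K) : Prop := ∀ a ∈ l, a ≠ 0

theorem NZ.append {l l' : List K} (h : NZ l) (h' : NZ l') : NZ (l ++ l') := by
  intro a ha; rcases List.mem_append.1 ha with h1 | h1; exacts [h a h1, h' a h1]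
theorem NZ.left {l l' : List K} (h : NZ (l ++ l')) : NZ l := fun a ha => h a (by simp [ha])
theorem NZ.right {l l' : List K} (h : NZ (l ++ l')) : NZ l' := fun a ha => h a (by simp [ha])
theorem NZ.cons {a : K} {l : List K} (h : a ≠ 0) (h' : NZ l) : NZ (a :: l) := by
  intro b hb; rcases List.mem_cons.1 hb with rfl | h1; exacts [h, h' b h1]
theorem NZ.head {a : K} {l : List K} (h : NZ (a :: l)) : a ≠ 0 := h a (by simp)
theorem NZ.tail {a : K} {l : List K} (h : NZ (a :: l)) : NZ l := fun b hb => h b (by simp [hb])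
theorem NZ.nil : NZ ([] : List K) := fun _ h => by simp at h
theorem NZ.sc {a : K} (ha : a ≠ 0) {l : List K} (h : NZ l) : NZ (sc a l) := by
  intro b hb
  obtain ⟨c, hc, rfl⟩ := List.mem_map.1 hb
  exact mul_ne_zero ha (h c hc)
theorem NZ.of_sc {a : K} {l : List K} (h : NZ (QF.sc a l)) : NZ l := by
  intro b hb hb0
  exact h (a * b) (List.mem_map.2 ⟨b, hb, rfl⟩) (by simp [hb0])
theorem NZ.map {L : Type} [Field L] (f : K →+* L) {l : List K} (h : NZ l) : NZ (l.map f) := by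
  intro b hb
  obtain ⟨c, hc, rfl⟩ := List.mem_map.1 hb
  exact (map_ne_zero f).2 (h c hc)

/-- Reflections act transitively on vectors of a given nonzero value. -/
theorem exists_isom {V : Type} [AddCommGroup V] [Module K V] (h2 : (2 : K) ≠ 0)
    (q : QuadraticForm K V) (x y : V) (hxy : q x = q y) (hx : q x ≠ 0) :
    ∃ e : V ≃ₗ[K] V, (∀ v, q (e v) = q v) ∧ e x = y := by
  have key : ∀ u : V, q u ≠ 0 → ∃ e : V ≃ₗ[K] V, (∀ v, q (e v) = q v) ∧
      ∀ v, e v = v - (QuadraticMap.polar q u v / q u) • u := by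
    intro u hu
    let f : V →ₗ[K] V := LinearMap.id - ((q u)⁻¹ • (QuadraticMap.polarBilin q u)).smulRight u
    have hf : ∀ v, f v = v - (QuadraticMap.polar q u v / q u) • u := by
      intro v
      simp [f, div_eq_inv_mul]
    have hinv : Function.Involutive f := by
      intro v
      rw [hf, hf, QuadraticMap.polar_sub_right, QuadraticMap.polar_smul_right,
        QuadraticMap.polar_self, sub_sub, ← add_smul]
      have : QuadraticMap.polar q u v / q u +
        (QuadraticMap.polar q u v - (QuadraticMap.polar q u v / q u) • (2 • q u)) / q u = 0 := by
        simp only [nsmul_eq_mul, smul_eq_mul]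
        field_simp
        push_cast
        ring
      rw [this]; simp
    refine ⟨LinearEquiv.ofInvolutive f hinv, ?_, hf⟩
    intro v
    rw [LinearEquiv.coe_ofInvolutive, hf, sub_eq_add_neg, QuadraticMap.map_add q,
      QuadraticMap.map_neg, QuadraticMap.polar_neg_right, QuadraticMap.polar_smul_right,
      QuadraticMap.map_smul, QuadraticMap.polar_comm q v u]
    simp only [smul_eq_mul]
    field_simp
    ring
  have e1 : q (x - y) = 2 * q x - QuadraticMap.polar q x y := by
    rw [sub_eq_add_neg, QuadraticMap.map_add q, QuadraticMap.map_neg, QuadraticMap.polar_neg_right,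
      ← hxy]; ring
  have e2 : q (x + y) = 2 * q x + QuadraticMap.polar q x y := by
    rw [QuadraticMap.map_add q, ← hxy]; ring
  by_cases h : q (x - y) = 0
  · have h' : q (x + y) ≠ 0 := by
      intro h0
      have : 2 * (2 * q x) = 0 := by linear_combination h + h0 - e1 - e2
      simp [h2, hx] at this
    obtain ⟨e, he, he'⟩ := key _ h'
    refine ⟨e.trans (LinearEquiv.neg K), fun v => ?_, ?_⟩
    · simp [he]
    · have : QuadraticMap.polar q (x + y) x = q (x + y) := by
        rw [QuadraticMap.polar_add_left, QuadraticMap.polar_self, e2,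
          QuadraticMap.polar_comm q y x]; simp [two_mul]
      simp [he', this, h']
  · obtain ⟨e, he, he'⟩ := key _ h
    refine ⟨e, he, ?_⟩
    have : QuadraticMap.polar q (x - y) x = q (x - y) := by
      rw [QuadraticMap.polar_sub_left, QuadraticMap.polar_self, e1,
          QuadraticMap.polar_comm q y x]; simp [two_mul]
    simp [he', this, h]

theorem cancel_fix {V W : Type} [AddCommGroup V] [Module K V] [AddCommGroup W] [Module K W]
    (h2 : (2 : K) ≠ 0) {a : K} (ha : a ≠ 0)
    (q : QuadraticForm K V) (r : QuadraticForm K W) (e : (K × V) ≃ₗ[K] (K × W))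
    (he : ∀ x, a * ((e x).1 * (e x).1) + r (e x).2 = a * (x.1 * x.1) + q x.2)
    (h1 : e (1, 0) = (1, 0)) (v : V) : (e (0, v)).1 = 0 := by
  have hs : e (1, v) = (1, 0) + e (0, v) := by
    have : ((1, v) : K × V) = (1, 0) + (0, v) := by simp
    rw [this, map_add, h1]
  have q1 := he (0, v)
  have q2 := he (1, v)
  rw [hs] at q2
  simp only [Prod.fst_add, Prod.snd_add, zero_add] at q1 q2
  have h3 : 2 * (a * (e (0, v)).1) = 0 := by linear_combination q2 - q1
  simpa [h2, ha] using h3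

theorem cancel_aux {V W : Type} [AddCommGroup V] [Module K V] [AddCommGroup W] [Module K W]
    (h2 : (2 : K) ≠ 0) {a : K} (ha : a ≠ 0)
    (q : QuadraticForm K V) (r : QuadraticForm K W) (e : (K × V) ≃ₗ[K] (K × W))
    (he : ∀ x, a * ((e x).1 * (e x).1) + r (e x).2 = a * (x.1 * x.1) + q x.2)
    (h1 : e (1, 0) = (1, 0)) :
    ∃ f : V ≃ₗ[K] W, (∀ v, r (f v) = q v) ∧ ∀ v, e (0, v) = (0, f v) := by
  have he' : ∀ x, a * ((e.symm x).1 * (e.symm x).1) + q (e.symm x).2 = a * (x.1 * x.1) + r x.2 :=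
    fun x => by rw [← he, e.apply_symm_apply]
  have h1' : e.symm (1, 0) = (1, 0) := by
    rw [← h1, e.symm_apply_apply]
  have f1 := cancel_fix h2 ha q r e he h1
  have f2 := cancel_fix h2 ha r q e.symm he' h1'
  let F : V →ₗ[K] W := (LinearMap.snd K K W) ∘ₗ e.toLinearMap ∘ₗ (LinearMap.inr K K V)
  let F' : W →ₗ[K] V :=
    (LinearMap.snd K K V) ∘ₗ e.symm.toLinearMap ∘ₗ (LinearMap.inr K K W)
  have hF : ∀ v, e (0, v) = (0, F v) := fun v => Prod.ext (f1 v) rfl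
  have hF' : ∀ v, e.symm (0, v) = (0, F' v) := fun v => Prod.ext (f2 v) rfl
  refine ⟨LinearEquiv.ofLinearMap F F' ?_ ?_, ?_, hF⟩
  · ext v
    have := hF (F' v)
    rw [← hF', e.apply_symm_apply] at this
    exact (congrArg Prod.snd this).symm
  · ext v
    have := hF' (F v)
    rw [← hF, e.symm_apply_apply] at this
    exact (congrArg Prod.snd this).symm
  · intro v
    have := he (0, v)
    rw [hF] at this
    simpa using this

theorem prod_q {V : Type} [AddCommGroup V] [Module K V] (a : K) (q : QuadraticForm K V)
    (x : K × V) : ((a • QuadraticMap.sq : QuadraticForm K K).prod q) x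
      = a * (x.1 * x.1) + q x.2 := rfl

theorem cancel_one (h2 : (2 : K) ≠ 0) {a : K} (ha : a ≠ 0) {φ ψ : QF K}
    (h : (add (r1 a) φ).Equiv (add (r1 a) ψ)) : φ.Equiv ψ := by
  obtain ⟨e0, he0⟩ : ∃ e : (K × φ.V) ≃ₗ[K] (K × ψ.V),
    ∀ x, ((a • QuadraticMap.sq : QuadraticForm K K).prod ψ.q) (e x)
      = ((a • QuadraticMap.sq : QuadraticForm K K).prod φ.q) x := h.out
  obtain ⟨t, ht, ht'⟩ := exists_isom h2 ((a • QuadraticMap.sq : QuadraticForm K K).prod ψ.q)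
    (e0 (1, 0)) (1, 0) (by rw [he0]; simp) (by rw [he0]; simp [ha])
  obtain ⟨f, hf, -⟩ := cancel_aux h2 ha φ.q ψ.q (e0.trans t) (fun x => by
    rw [← prod_q a ψ.q, LinearEquiv.trans_apply, ht, he0]; rfl) ht'
  exact Equiv.mk' f hf

theorem LE.cancel (h2 : (2 : K) ≠ 0) {l l₁ l₂ : List K} (hl : NZ l)
    (h : LE (l ++ l₁) (l ++ l₂)) : LE l₁ l₂ := by
  induction l with
  | nil => exact h
  | cons a l ih => exact ih hl.tail (cancel_one h2 hl.head h)

theorem LE.cancel_right (h2 : (2 : K) ≠ 0) {l l₁ l₂ : List K} (hl : NZ l)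
    (h : LE (l₁ ++ l) (l₂ ++ l)) : LE l₁ l₂ :=
  LE.cancel h2 hl ((LE.perm List.perm_append_comm).trans
    (h.trans (LE.perm List.perm_append_comm)))

end QF


namespace QF

variable {K : Type} [Field K]

theorem mat2_aux {V : Type} [AddCommGroup V] [Module K V] (f : QuadraticForm K V)
    {a b c d p q r s : K} (h1 : c * (p * p) + d * (r * r) = a)
    (h2 : c * (q * q) + d * (s * s) = b) (h3 : c * (p * q) + d * (r * s) = 0)
    (h4 : p * s - q * r ≠ 0) :
    ∃ e : (V × V) ≃ₗ[K] (V × V), ∀ x, c * f (e x).1 + d * f (e x).2 = a * f x.1 + b * f x.2 := by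
  let F : (V × V) →ₗ[K] (V × V) :=
    (p • LinearMap.fst K V V + q • LinearMap.snd K V V).prod
      (r • LinearMap.fst K V V + s • LinearMap.snd K V V)
  let D := (p * s - q * r)⁻¹
  have hD : D * (p * s - q * r) = 1 := inv_mul_cancel₀ h4
  let F' : (V × V) →ₗ[K] (V × V) :=
    ((D * s) • LinearMap.fst K V V - (D * q) • LinearMap.snd K V V).prod
      ((D * p) • LinearMap.snd K V V - (D * r) • LinearMap.fst K V V)
  refine ⟨LinearEquiv.ofLinearMap F F' ?_ ?_, ?_⟩
  · refine LinearMap.ext fun ⟨x, y⟩ => Prod.ext ?_ ?_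
    · change p • ((D * s) • x - (D * q) • y) + q • ((D * p) • y - (D * r) • x) = x
      have : p • ((D * s) • x - (D * q) • y) + q • ((D * p) • y - (D * r) • x)
        = (D * (p * s - q * r)) • x := by module
      rw [this, hD, one_smul]
    · change r • ((D * s) • x - (D * q) • y) + s • ((D * p) • y - (D * r) • x) = y
      have : r • ((D * s) • x - (D * q) • y) + s • ((D * p) • y - (D * r) • x)
        = (D * (p * s - q * r)) • y := by module
      rw [this, hD, one_smul]
  · refine LinearMap.ext fun ⟨x, y⟩ => Prod.ext ?_ ?_
    · change (D * s) • (p • x + q • y) - (D * q) • (r • x + s • y) = x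
      have : (D * s) • (p • x + q • y) - (D * q) • (r • x + s • y)
        = (D * (p * s - q * r)) • x := by module
      rw [this, hD, one_smul]
    · change (D * p) • (r • x + s • y) - (D * r) • (p • x + q • y) = y
      have : (D * p) • (r • x + s • y) - (D * r) • (p • x + q • y)
        = (D * (p * s - q * r)) • y := by module
      rw [this, hD, one_smul]
  · rintro ⟨x, y⟩
    change c * f (p • x + q • y) + d * f (r • x + s • y) = a * f x + b * f y
    rw [QuadraticMap.map_add f, QuadraticMap.map_add f, QuadraticMap.map_smul,
      QuadraticMap.map_smul, QuadraticMap.map_smul, QuadraticMap.map_smul,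
      QuadraticMap.polar_smul_left, QuadraticMap.polar_smul_left, QuadraticMap.polar_smul_right,
      QuadraticMap.polar_smul_right]
    simp only [smul_eq_mul]
    linear_combination f x * h1 + f y * h2 + QuadraticMap.polar f x y * h3

theorem LE.mat2 (l : List K) {a b c d p q r s : K} (h1 : c * (p * p) + d * (r * r) = a)
    (h2 : c * (q * q) + d * (s * s) = b) (h3 : c * (p * q) + d * (r * s) = 0)
    (h4 : p * s - q * r ≠ 0) : LE (QF.sc a l ++ QF.sc b l) (QF.sc c l ++ QF.sc d l) := by
  have key : (add (smul a (dg l)) (smul b (dg l))).Equiv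
      (add (smul c (dg l)) (smul d (dg l))) := by
    obtain ⟨e, he⟩ := mat2_aux (dg l).q h1 h2 h3 h4
    exact Equiv.mk' (φ := add (smul a (dg l)) (smul b (dg l)))
      (ψ := add (smul c (dg l)) (smul d (dg l))) e he
  exact (dg_append _ _).trans' ((add_congr (dg_sc _ _) (dg_sc _ _)).trans' (key.trans'
    ((add_congr (dg_sc _ _) (dg_sc _ _)).symm'.trans' (dg_append _ _).symm')))

theorem LE.mat2' {a b c d p q r s : K} (h1 : c * (p * p) + d * (r * r) = a)
    (h2 : c * (q * q) + d * (s * s) = b) (h3 : c * (p * q) + d * (r * s) = 0)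
    (h4 : p * s - q * r ≠ 0) : LE [a, b] [c, d] := by
  simpa using LE.mat2 [1] h1 h2 h3 h4

theorem LE.sq {a x : K} (hx : x ≠ 0) : LE [a * (x * x)] [a] := by
  have : (r1 (a * (x * x))).Equiv (r1 a) :=
    Equiv.mk' (φ := r1 (a * (x * x))) (ψ := r1 a)
      (LinearEquiv.smulOfNeZero K K x hx) fun (y : K) => by
      change a * ((x * y) * (x * y)) = a * (x * x) * (y * y)
      ring
  exact add_congr this (Equiv.rfl' _)

theorem Equiv.inv_q {φ ψ : QF K} {e : φ.V ≃ₗ[K] ψ.V} (he : ∀ x, ψ.q (e x) = φ.q x) (y : ψ.V) :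
    φ.q (e.symm y) = ψ.q y := by
  rw [← he, e.apply_symm_apply]

theorem dg_one_q (a x : K) (y : (dg ([] : List K)).V) : (dg [a]).q (x, y) = a * (x * x) := by
  have h : (dg ([] : List K)).q y = 0 := zero_q y
  exact (dg_cons_q a [] x y).trans (by rw [h, add_zero])

def Rep (l : List K) (c : K) : Prop := ∃ x : (dg l).V, (dg l).q x = c
/-- isotropy -/
def Iso (l : List K) : Prop := ∃ x : (dg l).V, x ≠ 0 ∧ (dg l).q x = 0

theorem LE.rep {l l' : List K} (h : LE l l') {c : K} (hc : Rep l c) : Rep l' c := by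
  obtain ⟨e, he⟩ := Equiv.out h
  obtain ⟨x, hx⟩ := hc
  exact ⟨e x, (he x).trans hx⟩

theorem LE.iso {l l' : List K} (h : LE l l') (hc : Iso l) : Iso l' := by
  obtain ⟨e, he⟩ := Equiv.out h
  obtain ⟨x, hx, hx'⟩ := hc
  exact ⟨e x, by simpa using hx, (he x).trans hx'⟩

theorem rep_zero (l : List K) : Rep l 0 := ⟨0, by simp⟩

theorem rep_nil {c : K} : Rep [] c ↔ c = 0 := by
  constructor
  · rintro ⟨x, rfl⟩; exact zero_q x
  · rintro rfl; exact rep_zero _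

theorem not_iso_nil : ¬ Iso ([] : List K) := by
  rintro ⟨x, hx, -⟩
  apply hx
  exact (Subsingleton.elim (α := Fin 0 → K) x 0)

theorem rep_append {l l' : List K} {c : K} :
    Rep (l ++ l') c ↔ ∃ u v, Rep l u ∧ Rep l' v ∧ c = u + v := by
  obtain ⟨e, he⟩ := (dg_append l l').out
  constructor
  · rintro ⟨x, rfl⟩
    exact ⟨_, _, ⟨(e x).1, rfl⟩, ⟨(e x).2, rfl⟩, (he x).symm⟩
  · rintro ⟨_, _, ⟨x, rfl⟩, ⟨y, rfl⟩, rfl⟩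
    exact ⟨e.symm (x, y), Equiv.inv_q he (x, y)⟩

theorem iso_append {l l' : List K} (h : Iso (l ++ l')) :
    Iso l ∨ Iso l' ∨ ∃ u, u ≠ 0 ∧ Rep l u ∧ Rep l' (-u) := by
  obtain ⟨e, he⟩ := (dg_append l l').out
  obtain ⟨x, hx, hx0⟩ := h
  have h0 : (dg l).q (e x).1 + (dg l').q (e x).2 = 0 := (he x).trans hx0
  by_cases hu : (dg l).q (e x).1 = 0
  · have hv : (dg l').q (e x).2 = 0 := by rwa [hu, zero_add] at h0
    by_cases h1 : (e x).1 = 0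
    · by_cases h3 : (e x).2 = 0
      · exact absurd ((map_eq_zero_iff e e.injective).1 (Prod.ext h1 h3)) hx
      · exact Or.inr (Or.inl ⟨_, h3, hv⟩)
    · exact Or.inl ⟨_, h1, hu⟩
  · exact Or.inr (Or.inr ⟨_, hu, ⟨_, rfl⟩, ⟨_, (neg_eq_of_add_eq_zero_right h0).symm⟩⟩)

theorem iso_left {l l' : List K} (h : Iso l) : Iso (l ++ l') := by
  obtain ⟨e, he⟩ := (dg_append l l').out
  obtain ⟨x, hx, hx0⟩ := h
  refine ⟨e.symm (x, 0), ?_, ?_⟩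
  · intro h
    have := (map_eq_zero_iff e.symm e.symm.injective).1 h
    exact hx (congrArg Prod.fst this)
  · refine (Equiv.inv_q he (x, 0)).trans ((add_q _ _ _ _).trans ?_)
    rw [hx0, map_zero, add_zero]

theorem iso_right {l l' : List K} (h : Iso l') : Iso (l ++ l') :=
  (LE.perm List.perm_append_comm).iso (iso_left (l' := l) h)

theorem rep_sc {a : K} {l : List K} {c : K} : Rep (sc a l) c ↔ ∃ d, Rep l d ∧ c = a * d := by
  obtain ⟨e, he⟩ := (dg_sc a l).out
  constructor
  · rintro ⟨x, rfl⟩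
    exact ⟨_, ⟨e x, rfl⟩, (he x).symm⟩
  · rintro ⟨_, ⟨x, rfl⟩, rfl⟩
    exact ⟨e.symm x, Equiv.inv_q he x⟩

theorem iso_sc {a : K} (ha : a ≠ 0) {l : List K} (h : Iso (sc a l)) : Iso l := by
  obtain ⟨e, he⟩ := (dg_sc a l).out
  obtain ⟨x, hx, hx0⟩ := h
  refine ⟨e x, fun h => hx ((map_eq_zero_iff e e.injective).1 h), ?_⟩
  have : a * (dg l).q (e x) = 0 := (he x).trans hx0
  simpa [ha] using this

theorem rep_one {a c : K} : Rep [a] c ↔ ∃ x, c = a * (x * x) := by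
  constructor
  · rintro ⟨⟨x, y⟩, rfl⟩
    exact ⟨x, dg_one_q a x y⟩
  · rintro ⟨x, rfl⟩
    exact ⟨((x : K), 0), dg_one_q a x 0⟩

theorem iso_one {a : K} (ha : a ≠ 0) : ¬ Iso [a] := by
  rintro ⟨⟨x, y⟩, hx, h0⟩
  have key : ∀ z : K, a * (z * z) = 0 → z = 0 := fun z h => by
    rcases mul_eq_zero.1 h with h | h
    · exact absurd h ha
    · exact mul_self_eq_zero.1 h
  have hx0 : x = (0 : K) := key x ((dg_one_q a x y).symm.trans h0)
  exact hx (Prod.ext hx0 (Subsingleton.elim (α := Fin 0 → K) y 0))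

theorem rep_cons {a : K} {l : List K} {c : K} :
    Rep (a :: l) c ↔ ∃ x v, Rep l v ∧ c = a * (x * x) + v := by
  have := rep_append (l := [a]) (l' := l) (c := c)
  rw [List.singleton_append] at this
  rw [this]
  constructor
  · rintro ⟨u, v, hu, hv, rfl⟩
    obtain ⟨x, rfl⟩ := rep_one.1 hu
    exact ⟨x, v, hv, rfl⟩
  · rintro ⟨x, v, hv, rfl⟩
    exact ⟨_, v, rep_one.2 ⟨x, rfl⟩, hv, rfl⟩

theorem iso_cons {a : K} (ha : a ≠ 0) {l : List K} (h : Iso (a :: l)) :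
    Iso l ∨ ∃ x, x ≠ 0 ∧ Rep l (-(a * (x * x))) := by
  rcases iso_append (l := [a]) (l' := l) h with h | h | ⟨u, hu, h, h'⟩
  · exact absurd h (iso_one ha)
  · exact Or.inl h
  · obtain ⟨x, rfl⟩ := rep_one.1 h
    refine Or.inr ⟨x, ?_, h'⟩
    rintro rfl
    simp at hu

theorem rep_split {l : List K} (hl : NZ l) {d : K} (hd : d ≠ 0) (h : Rep l d) :
    ∃ l', NZ l' ∧ LE l (d :: l') := by
  induction l generalizing d with
  | nil => exact absurd (rep_nil.1 h) hd
  | cons a l ih =>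
    obtain ⟨x, e, he, rfl⟩ := rep_cons.1 h
    by_cases he0 : e = 0
    · subst he0
      rw [add_zero] at hd ⊢
      have hx : x ≠ 0 := by rintro rfl; simp at hd
      exact ⟨l, hl.tail, LE.append (l₁ := [a]) (l₁' := [a * (x * x)]) (LE.sq hx).symm (LE.refl l)⟩
    · obtain ⟨l', hl', hle⟩ := ih hl.tail he0 he
      refine ⟨(a * e * (a * (x * x) + e)) :: l', NZ.cons
        (mul_ne_zero (mul_ne_zero hl.head he0) hd) hl', ?_⟩
      refine (hle.cons a).trans (LE.append (l₁ := [a, e])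
        (l₁' := [a * (x * x) + e, a * e * (a * (x * x) + e)]) ?_ (LE.refl l'))
      refine LE.symm (LE.mat2' (p := x) (q := -e) (r := 1) (s := a * x) ?_ ?_ ?_ ?_)
      · ring
      · ring
      · ring
      · intro h; apply hd; linear_combination h

theorem LE.hyp2 (h2 : (2 : K) ≠ 0) {a : K} (ha : a ≠ 0) : LE [a, -a] [1, -1] := by
  refine LE.mat2' (p := (a + 1) / 2) (q := (1 - a) / 2) (r := (1 - a) / 2) (s := (a + 1) / 2)
    ?_ ?_ ?_ ?_
  · field_simp; ring
  · field_simp; ring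
  · field_simp; ring
  · have : (a + 1) / 2 * ((a + 1) / 2) - (1 - a) / 2 * ((1 - a) / 2) = a := by
      field_simp; ring
    rw [this]; exact ha

theorem iso_split (h2 : (2 : K) ≠ 0) {l : List K} (hl : NZ l) (h : Iso l) :
    ∃ l', NZ l' ∧ LE l (1 :: -1 :: l') := by
  induction l with
  | nil => exact absurd h not_iso_nil
  | cons a l ih =>
    rcases iso_cons hl.head h with h | ⟨x, hx, h⟩
    · obtain ⟨l', hl', hle⟩ := ih hl.tail h
      refine ⟨a :: l', hl'.cons hl.head, (hle.cons a).trans (LE.perm ?_)⟩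
      exact (List.Perm.swap _ _ _).trans ((List.Perm.swap _ _ _).cons _)
    · have ha := hl.head
      obtain ⟨l', hl', hle⟩ := rep_split hl.tail (by simp [ha, hx]) h
      refine ⟨l', hl', (hle.cons a).trans ?_⟩
      refine LE.append (l₁ := [a, -(a * (x * x))]) (l₁' := [1, -1]) ?_ (LE.refl l')
      refine LE.trans ?_ (LE.hyp2 h2 ha)
      refine LE.append (l₁ := [a]) (l₁' := [a]) (LE.refl _) ?_
      rw [← neg_mul]
      exact LE.sq hx

/-- list of hyperbolic planes -/
def hypL : ℕ → List K
  | 0 => []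
  | m + 1 => 1 :: -1 :: hypL m

theorem hypL_length (m : ℕ) : (hypL m : List K).length = 2 * m := by
  induction m with
  | zero => rfl
  | succ m ih => simp [hypL, ih]; ring

theorem hypL_add (m n : ℕ) : (hypL (m + n) : List K) = hypL m ++ hypL n := by
  induction m with
  | zero => simp [hypL]
  | succ m ih => rw [Nat.add_right_comm]; simp [hypL, ih]

theorem hypL_nz (m : ℕ) : NZ (hypL m : List K) := by
  induction m with
  | zero => exact NZ.nil
  | succ m ih => exact NZ.cons one_ne_zero (NZ.cons (neg_ne_zero.2 one_ne_zero) ih)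

theorem hypL_map {L : Type} [Field L] (f : K →+* L) (m : ℕ) : (hypL m : List K).map f = hypL m := by
  induction m with
  | zero => rfl
  | succ m ih => simp [hypL, ih]

/-- hyperbolic lists -/
def Hyp' (l : List K) : Prop := ∃ m, LE l (hypL m)

theorem Hyp'.of_LE {l l' : List K} (h : LE l l') (h' : Hyp' l') : Hyp' l := by
  obtain ⟨m, hm⟩ := h'; exact ⟨m, h.trans hm⟩

theorem Hyp'.of_perm {l l' : List K} (h' : Hyp' l') (h : l.Perm l') : Hyp' l := h'.of_LE (LE.perm h)

theorem Hyp'.append {l l' : List K} (h : Hyp' l) (h' : Hyp' l') : Hyp' (l ++ l') := by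
  obtain ⟨m, hm⟩ := h
  obtain ⟨n, hn⟩ := h'
  exact ⟨m + n, by rw [hypL_add]; exact hm.append hn⟩

theorem Hyp'.cancel (h2 : (2 : K) ≠ 0) {l l' : List K} (h : Hyp' l) (h' : Hyp' (l ++ l')) :
    Hyp' l' := by
  obtain ⟨m, hm⟩ := h
  obtain ⟨n, hn⟩ := h'
  have h3 : LE (hypL m ++ l') (hypL n) := (hm.symm.append (LE.refl l')).trans hn
  have hlen := h3.length
  rw [List.length_append, hypL_length, hypL_length] at hlen
  obtain ⟨k, rfl⟩ := Nat.exists_eq_add_of_le (show m ≤ n by omega)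
  rw [hypL_add] at h3
  exact ⟨k, LE.cancel h2 (hypL_nz m) h3⟩

theorem Hyp'.neg (h2 : (2 : K) ≠ 0) {l : List K} (hl : NZ l) : Hyp' (l ++ sc (-1) l) := by
  induction l with
  | nil => exact ⟨0, LE.refl _⟩
  | cons a l ih =>
    have h1 : Hyp' [a, -a] := ⟨1, LE.hyp2 h2 hl.head⟩
    refine (h1.append (ih hl.tail)).of_perm ?_
    simp only [sc_cons, neg_one_mul, List.cons_append, List.nil_append]
    exact List.Perm.cons _ List.perm_middle

theorem Hyp'.neg' (h2 : (2 : K) ≠ 0) {l : List K} (hl : NZ l) (a : K) (ha : a ≠ 0) :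
    Hyp' (QF.sc a l ++ QF.sc (-a) l) := by
  have := Hyp'.neg h2 (hl.sc ha)
  simpa using this

theorem Hyp'.sc (h2 : (2 : K) ≠ 0) {l : List K} (h : Hyp' l) {a : K} (ha : a ≠ 0) :
    Hyp' (QF.sc a l) := by
  obtain ⟨m, hm⟩ := h
  refine Hyp'.of_LE (hm.sc a) ?_
  clear hm
  induction m with
  | zero => exact ⟨0, LE.refl _⟩
  | succ m ih =>
    have h1 : Hyp' [a, -a] := ⟨1, LE.hyp2 h2 ha⟩
    simpa [hypL] using h1.append ih

theorem Hyp'.iso (h2 : (2 : K) ≠ 0) {l : List K} (h : Hyp' l) (h0 : l ≠ []) : Iso l := by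
  obtain ⟨m, hm⟩ := h
  cases m with
  | zero => exact absurd (List.length_eq_zero_iff.1 hm.length) h0
  | succ m =>
    refine hm.symm.iso (iso_left (l := [1, -1]) (l' := hypL m) ?_)
    refine ⟨((1 : K), ((1 : K), 0)), ?_, ?_⟩
    · intro h
      exact one_ne_zero (α := K) (congrArg Prod.fst h)
    · refine (dg_cons_q 1 [-1] 1 ((1 : K), 0)).trans ?_
      have : (dg [(-1 : K)]).q ((1 : K), 0) = (-1) * (1 * 1) := dg_one_q _ _ _
      refine (congrArg (fun z : K => 1 * (1 * 1) + z) this).trans ?_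
      ring

theorem witt_decomp (h2 : (2 : K) ≠ 0) {l : List K} (hl : NZ l) :
    ∃ m l', NZ l' ∧ ¬ Iso l' ∧ LE l (hypL m ++ l') := by
  induction hn : l.length using Nat.strong_induction_on generalizing l with
  | _ n ih =>
    by_cases h : Iso l
    · obtain ⟨l', hl', hle⟩ := iso_split h2 hl h
      have := hle.length
      simp at this
      obtain ⟨m, l'', h1, h3, h4⟩ := ih l'.length (by omega) hl' rfl
      exact ⟨m + 1, l'', h1, h3, hle.trans ((h4.cons _).cons _)⟩
    · exact ⟨0, l, hl, h, LE.refl _⟩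

end QF


namespace QF

variable {K : Type} [Field K]

/-- Pfister list -/
def pf : List K → List K
  | [] => [1]
  | a :: l => pf l ++ sc (-a) (pf l)

theorem pf_length (l : List K) : (pf l).length = 2 ^ l.length := by
  induction l with
  | nil => rfl
  | cons a l ih => simp [pf, ih]; ring

theorem pf_head (l : List K) : ∃ t, pf l = 1 :: t := by
  induction l with
  | nil => exact ⟨[], rfl⟩
  | cons a l ih =>
    obtain ⟨t, ht⟩ := ih
    exact ⟨t ++ sc (-a) (1 :: t), by rw [pf, ht]; rfl⟩

theorem pf_map {L : Type} [Field L] (f : K →+* L) (l : List K) :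
    (pf l).map f = pf (l.map f) := by
  induction l with
  | nil => simp [pf]
  | cons a l ih => simp [pf, ih, sc_map]

theorem LE.bin (σ : List K) {u w : K} (h : u + w ≠ 0) :
    LE (QF.sc u σ ++ QF.sc w σ) (QF.sc (u + w) σ ++ QF.sc ((u + w) * (u * w)) σ) := by
  refine LE.symm (LE.mat2 σ (p := 1) (q := -w) (r := 1) (s := u) ?_ ?_ ?_ ?_)
  · ring
  · ring
  · ring
  · intro h'; apply h; linear_combination h'

theorem pf_round (h2 : (2 : K) ≠ 0) (l : List K) (hl : NZ (pf l)) :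
    (∀ b, b ≠ 0 → Rep (pf l) b → LE (sc b (pf l)) (pf l)) ∧ (Iso (pf l) → Hyp' (pf l)) := by
  induction l with
  | nil =>
    constructor
    · intro b hb h
      obtain ⟨x, hx⟩ := rep_one.1 h
      have hx0 : x ≠ 0 := by rintro rfl; simp at hx; exact hb hx
      have := LE.sq (a := 1) hx0
      rw [← hx] at this
      simpa [pf] using this
    · intro h; exact absurd h (iso_one one_ne_zero)
  | cons a l ih =>
    have hσ : NZ (pf l) := NZ.left (l' := sc (-a) (pf l)) hl
    obtain ⟨ih1, ih2⟩ := ih hσ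
    obtain ⟨t, ht⟩ := pf_head l
    have ha : a ≠ 0 := by
      have h3 : NZ (sc (-a) (pf l)) := NZ.right (l := pf l) hl
      rw [ht, sc_cons] at h3
      simpa using h3.head
    have hsq : ∀ c, Rep (pf l) (c * c) := fun c => by
      rw [ht]; exact rep_cons.2 ⟨c, 0, rep_zero _, by ring⟩
    constructor
    · intro b hb h
      rw [pf] at h ⊢
      obtain ⟨u, w, hu, hw, rfl⟩ := rep_append.1 h
      obtain ⟨v, hv, rfl⟩ := rep_sc.1 hw
      by_cases hv0 : v = 0
      · subst hv0
        rw [mul_zero, add_zero] at hb ⊢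
        have h1 := ih1 u hb hu
        rw [sc_append]
        refine h1.append ?_
        have := h1.sc (-a)
        rwa [sc_sc, mul_comm, ← sc_sc] at this
      · have h1 := ih1 v hv0 hv
        by_cases hu0 : u = 0
        · subst hu0
          rw [zero_add]
          rw [sc_append]
          have h3 : LE (sc (-a * v) (pf l)) (sc (-a) (pf l)) := by
            rw [← sc_sc]; exact h1.sc _
          have h4 : LE (sc (-a * v) (sc (-a) (pf l))) (pf l) := by
            have : LE (sc (a * a) (sc v (pf l))) (pf l) :=
              (h1.sc _).trans (ih1 _ (mul_ne_zero ha ha) (hsq a))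
            rw [sc_sc] at this ⊢
            convert this using 2
            ring
          exact (h3.append h4).trans (LE.perm List.perm_append_comm)
        · have h3 := ih1 u hu0 hu
          have hπ : LE (pf l ++ sc (-a) (pf l)) (sc u (pf l) ++ sc (-a * v) (pf l)) := by
            refine h3.symm.append ?_
            rw [← sc_sc]; exact (h1.sc _).symm
          refine LE.symm (hπ.trans ((LE.bin _ hb).trans ?_))
          rw [sc_append]
          refine (LE.refl _).append ?_
          rw [← sc_sc]
          refine LE.sc _ ?_
          have : u * (-a * v) = -a * (u * v) := by ring
          rw [this, ← sc_sc]
          refine LE.sc _ ?_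
          rw [← sc_sc]
          exact (h1.sc u).trans h3
    · intro h
      rw [pf] at h ⊢
      have hna : -a ≠ 0 := neg_ne_zero.2 ha
      have key : Iso (pf l) → Hyp' (pf l ++ sc (-a) (pf l)) := fun h =>
        (ih2 h).append ((ih2 h).sc h2 hna)
      rcases iso_append h with h | h | ⟨u, hu, h, h'⟩
      · exact key h
      · exact key (iso_sc hna h)
      · obtain ⟨v, hv, hv'⟩ := rep_sc.1 h'
        have huv : u = a * v := by linear_combination -hv'
        have hv0 : v ≠ 0 := by rintro rfl; simp at huv; exact hu huv
        have h3 : LE (sc (-a) (pf l)) (sc (-u) (pf l)) := by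
          rw [huv, ← neg_mul, ← sc_sc]; exact ((ih1 v hv0 hv).sc _).symm
        exact Hyp'.of_LE ((ih1 u hu h).symm.append h3) (Hyp'.neg' h2 hσ u hu)

end QF


namespace QF

variable {K : Type} [Field K]

/-- isometry after every base change -/
def LEs (l l' : List K) : Prop := ∀ (L : Type) [Field L] (f : K →+* L), LE (l.map f) (l'.map f)

theorem LEs.trans {l l' l'' : List K} (h : LEs l l') (h' : LEs l' l'') : LEs l l'' :=
  fun L _ f => (h L f).trans (h' L f)
theorem LEs.symm {l l' : List K} (h : LEs l l') : LEs l' l := fun L _ f => (h L f).symm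
theorem LEs.cons (a : K) {l l' : List K} (h : LEs l l') : LEs (a :: l) (a :: l') :=
  fun L _ f => (h L f).cons (f a)
theorem LEs.le {l l' : List K} (h : LEs l l') : LE l l' := by
  simpa using h K (RingHom.id K)

theorem rep_split_s {l : List K} (hl : NZ l) {d : K} (hd : d ≠ 0) (h : Rep l d) :
    ∃ l', NZ l' ∧ LEs l (d :: l') := by
  induction l generalizing d with
  | nil => exact absurd (rep_nil.1 h) hd
  | cons a l ih =>
    obtain ⟨x, e, he, rfl⟩ := rep_cons.1 h
    by_cases he0 : e = 0
    · subst he0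
      rw [add_zero] at hd ⊢
      have hx : x ≠ 0 := by rintro rfl; simp at hd
      refine ⟨l, hl.tail, fun L _ f => ?_⟩
      refine LE.append (l₁ := [f a]) (l₁' := [f (a * (x * x))]) (LE.symm ?_) (LE.refl (l.map f))
      rw [map_mul, map_mul]
      exact LE.sq ((map_ne_zero f).2 hx)
    · obtain ⟨l', hl', hle⟩ := ih hl.tail he0 he
      refine ⟨(a * e * (a * (x * x) + e)) :: l', NZ.cons
        (mul_ne_zero (mul_ne_zero hl.head he0) hd) hl', ?_⟩
      refine (hle.cons a).trans (fun L _ f => ?_)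
      refine (LE.append (l₁ := [f a, f e])
        (l₁' := [f (a * (x * x) + e), f (a * e * (a * (x * x) + e))]) ?_ (LE.refl (l'.map f)))
      refine LE.symm (LE.mat2' (p := f x) (q := -f e) (r := 1) (s := f a * f x) ?_ ?_ ?_ ?_)
      · simp only [map_mul, map_add]; ring
      · simp only [map_mul, map_add]; ring
      · ring
      · intro h; apply (map_ne_zero f).2 hd
        simp only [map_mul, map_add]; linear_combination h

theorem LE.stable (h2 : (2 : K) ≠ 0) {l l' : List K} (hl : NZ l) (hl' : NZ l') (h : LE l l') :
    LEs l l' := by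
  induction l generalizing l' with
  | nil =>
    have : l' = [] := List.length_eq_zero_iff.1 h.symm.length
    subst this
    exact fun L _ f => LE.refl _
  | cons a l ih =>
    have ha := hl.head
    have h1 : Rep (a :: l) a := rep_cons.2 ⟨1, 0, rep_zero _, by ring⟩
    obtain ⟨l'', h3, h4⟩ := rep_split_s hl' ha (h.rep h1)
    have h5 : LE l l'' := cancel_one h2 ha (h.trans h4.le)
    exact ((ih hl.tail h3 h5).cons a).trans h4.symm

theorem Hyp'.map (h2 : (2 : K) ≠ 0) {l : List K} (hl : NZ l) (h : Hyp' l)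
    {L : Type} [Field L] (f : K →+* L) : Hyp' (l.map f) := by
  obtain ⟨m, hm⟩ := h
  refine ⟨m, ?_⟩
  have := hm.stable h2 hl (hypL_nz m) L f
  rwa [hypL_map] at this

theorem coord {L : Type} [Field L] (f : K →+* L) (l : List K) :
    ∃ e : (Fin l.length → L) ≃ₗ[L] (dg (l.map f)).V,
      ∀ x, (dg (l.map f)).q (e x) = ∑ i, f (l.get i) * (x i * x i) := by
  induction l with
  | nil =>
    refine ⟨LinearEquiv.refl L (Fin 0 → L), fun x => ?_⟩
    exact (zero_q x).trans (by simp)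
  | cons a l ih =>
    obtain ⟨e, he⟩ := ih
    refine ⟨(Fin.consLinearEquiv L (fun _ : Fin (l.length + 1) => L)).symm.trans
      (LinearEquiv.prodCongr (LinearEquiv.refl L L) e), fun x => ?_⟩
    refine (dg_cons_q (f a) (l.map f) (x 0) (e (fun i => x i.succ))).trans ?_
    rw [he]
    exact (Fin.sum_univ_succ (fun i : Fin (l.length + 1) =>
      f ((a :: l).get i) * (x i * x i))).symm

theorem coordK (l : List K) :
    ∃ e : (Fin l.length → K) ≃ₗ[K] (dg l).V,
      ∀ x, (dg l).q (e x) = ∑ i, l.get i * (x i * x i) := by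
  have := coord (RingHom.id K) l
  rw [show l.map (RingHom.id K) = l from List.map_id l] at this
  exact this

theorem rep_map_iff {L : Type} [Field L] (f : K →+* L) (l : List K) (c : L) :
    Rep (l.map f) c ↔ ∃ x : Fin l.length → L, ∑ i, f (l.get i) * (x i * x i) = c := by
  obtain ⟨e, he⟩ := coord f l
  constructor
  · rintro ⟨y, rfl⟩
    refine ⟨e.symm y, ?_⟩
    rw [← he, e.apply_symm_apply]
  · rintro ⟨x, rfl⟩
    exact ⟨e x, he x⟩

theorem iso_map_iff {L : Type} [Field L] (f : K →+* L) (l : List K) :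
    Iso (l.map f) ↔ ∃ x : Fin l.length → L, x ≠ 0 ∧ ∑ i, f (l.get i) * (x i * x i) = 0 := by
  obtain ⟨e, he⟩ := coord f l
  constructor
  · rintro ⟨y, hy, h0⟩
    refine ⟨e.symm y, by simpa using hy, ?_⟩
    rw [← he, e.apply_symm_apply, h0]
  · rintro ⟨x, hx, h0⟩
    exact ⟨e x, by simpa using hx, (he x).trans h0⟩

theorem rep_iff (l : List K) (c : K) :
    Rep l c ↔ ∃ x : Fin l.length → K, ∑ i, l.get i * (x i * x i) = c := by
  simpa using rep_map_iff (RingHom.id K) l c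

theorem iso_iff (l : List K) :
    Iso l ↔ ∃ x : Fin l.length → K, x ≠ 0 ∧ ∑ i, l.get i * (x i * x i) = 0 := by
  simpa using iso_map_iff (RingHom.id K) l

theorem orth_aux {V : Type} [AddCommGroup V] [Module K V] (h2 : (2 : K) ≠ 0) {d : K} (hd : d ≠ 0)
    (q : QuadraticForm K V) (x y : K × V) (hx : d * (x.1 * x.1) + q x.2 = d)
    (hxy : d * ((x + y).1 * (x + y).1) + q (x + y).2 = d + (d * (y.1 * y.1) + q y.2)) :
    ∃ v, q v = d * (y.1 * y.1) + q y.2 := by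
  let Q : QuadraticForm K (K × V) := (d • QuadraticMap.sq : QuadraticForm K K).prod q
  have hQ : ∀ z, Q z = d * (z.1 * z.1) + q z.2 := fun z => rfl
  have h10 : Q (1, 0) = d := by rw [hQ]; simp
  obtain ⟨g, hg, hgx⟩ := exists_isom h2 Q x (1, 0) (by rw [hQ, h10]; exact hx)
    (by rw [hQ, hx]; exact hd)
  have h1 : Q (g (x + y)) = d + Q (g y) := by rw [hg, hg, hQ, hQ]; exact hxy
  rw [map_add, hgx, hQ, hQ] at h1
  have h3 : (g y).1 = 0 := by
    simp only [Prod.fst_add, Prod.snd_add, zero_add] at h1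
    have : 2 * d * (g y).1 = 0 := by linear_combination h1
    simpa [h2, hd] using this
  refine ⟨(g y).2, ?_⟩
  have := hg y
  rw [hQ, hQ, h3] at this
  simpa using this

theorem orth_split (h2 : (2 : K) ≠ 0) {l : List K} (hl : NZ l) (x y : Fin l.length → K) {d e : K}
    (hd : d ≠ 0) (hx : ∑ i, l.get i * (x i * x i) = d) (hy : ∑ i, l.get i * (y i * y i) = e)
    (hxy : ∑ i, l.get i * (x i * y i) = 0) :
    ∃ l', NZ l' ∧ LE l (d :: l') ∧ Rep l' e := by
  obtain ⟨l', hl', hle⟩ := rep_split hl hd ((rep_iff l d).2 ⟨x, hx⟩)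
  refine ⟨l', hl', hle, ?_⟩
  obtain ⟨E, hE⟩ := coordK l
  obtain ⟨F, hF⟩ := Equiv.out hle
  have key : ∀ z, (dg (d :: l')).q (F (E z)) = ∑ i, l.get i * (z i * z i) := fun z =>
    (hF _).trans (hE z)
  have hadd : ∑ i, l.get i * ((x + y) i * (x + y) i) = d + e := by
    have h3 : d + e = d + e + 2 * 0 := by ring
    rw [h3, ← hx, ← hy, ← hxy, Finset.mul_sum,
      ← Finset.sum_add_distrib, ← Finset.sum_add_distrib]
    refine Finset.sum_congr rfl fun i _ => ?_
    simp only [Pi.add_apply]; ring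
  have kx := (key x).trans hx
  have ky := (key y).trans hy
  have kxy := (key (x + y)).trans hadd
  rw [map_add, map_add] at kxy
  obtain ⟨v, hv⟩ := orth_aux h2 hd (dg l').q (F (E x)) (F (E y)) kx (kxy.trans (by
    exact congrArg (d + ·) ky.symm))
  exact ⟨v, hv.trans ky⟩

end QF


namespace QF

open Polynomial

variable {K : Type} [Field K]

/-- diagonal form on polynomials -/
noncomputable def PQ {n : ℕ} (w : Fin n → K) (x : Fin n → K[X]) : K[X] :=
  ∑ i, C (w i) * (x i * x i)

theorem PQ_coeff {n : ℕ} (w : Fin n → K) (x : Fin n → K[X]) (N : ℕ)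
    (hx : ∀ i, (x i).natDegree ≤ N) :
    (PQ w x).coeff (N + N) = ∑ i, w i * ((x i).coeff N * (x i).coeff N) := by
  rw [PQ, finsetSum_coeff]
  refine Finset.sum_congr rfl fun i _ => ?_
  rw [coeff_C_mul, coeff_mul_add_eq_of_natDegree_le (hx i) (hx i)]

theorem PQ_deg {n : ℕ} (w : Fin n → K)
    (hw : ∀ x : Fin n → K, ∑ i, w i * (x i * x i) = 0 → x = 0) (x : Fin n → K[X]) (M : ℕ)
    (h : (PQ w x).degree < ((M + M : ℕ) : WithBot ℕ)) : ∀ i, (x i).degree < (M : WithBot ℕ) := by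
  have key : ∀ N : ℕ, (∀ i, (x i).degree < ((M + N : ℕ) : WithBot ℕ)) →
      ∀ i, (x i).degree < (M : WithBot ℕ) := by
    intro N
    induction N with
    | zero => intro h; simpa using h
    | succ N ih =>
      intro h3
      apply ih
      have h4 : ∀ i, (x i).natDegree ≤ M + N := fun i => by
        have := h3 i
        rw [natDegree_le_iff_degree_le]
        exact Order.lt_succ_iff.1 this
      have h5 := PQ_coeff w x (M + N) h4
      rw [coeff_eq_zero_of_degree_lt (lt_of_lt_of_le h (by exact_mod_cast (by omega)))] at h5
      have h6 := hw _ h5.symm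
      intro i
      refine lt_of_le_of_ne (natDegree_le_iff_degree_le.1 (h4 i)) fun h7 => ?_
      exact coeff_ne_zero_of_eq_degree h7 (congrFun h6 i)
  refine key (Finset.univ.sup (fun i => (x i).natDegree) + 1) fun i => ?_
  refine lt_of_le_of_lt degree_le_natDegree ?_
  have := Finset.le_sup (f := fun i => (x i).natDegree) (Finset.mem_univ i)
  exact_mod_cast (by omega)

theorem PQ_aniso {n : ℕ} (w : Fin n → K)
    (hw : ∀ x : Fin n → K, ∑ i, w i * (x i * x i) = 0 → x = 0) (x : Fin n → K[X])
    (h : PQ w x = 0) : x = 0 := by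
  have := PQ_deg w hw x 0 (by rw [h]; simp)
  funext i
  simpa using this i

theorem cassels_poly {n : ℕ} (w : Fin n → K)
    (hw : ∀ x : Fin n → K, ∑ i, w i * (x i * x i) = 0 → x = 0) (p : K[X]) (N : ℕ) :
    ∀ (h : K[X]) (x : Fin n → K[X]), h ≠ 0 → h.natDegree = N → PQ w x = p * (h * h) →
      ∃ y, PQ w y = p := by
  induction N using Nat.strong_induction_on with
  | _ N ih =>
  intro h x h0 hN hx
  let y : Fin n → K[X] := fun i => x i / h
  let r : Fin n → K[X] := fun i => x i % h
  have hxy : ∀ i, x i = h * y i + r i := fun i => (EuclideanDomain.div_add_mod (x i) h).symm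
  have hhy : PQ w (fun i => h * y i) = (h * h) * PQ w y := by
    simp only [PQ, Finset.mul_sum]
    exact Finset.sum_congr rfl fun i _ => by ring
  by_cases hr : r = 0
  · refine ⟨y, ?_⟩
    have : x = fun i => h * y i := by
      funext i; rw [hxy i, hr]; simp
    rw [this, hhy] at hx
    have h3 : h * h ≠ 0 := mul_ne_zero h0 h0
    apply mul_left_cancel₀ h3
    rw [hx]; ring
  · let B : K[X] := ∑ i, C (w i) * (x i * y i)
    let a := PQ w y - p
    let b := 2 * (p * h - B)
    let x' : Fin n → K[X] := fun i => a * x i + b * y i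
    let h' := a * h + b
    have e1 : PQ w x' = a * a * PQ w x + 2 * a * b * B + b * b * PQ w y := by
      simp only [PQ, B, x', Finset.mul_sum, ← Finset.sum_add_distrib]
      exact Finset.sum_congr rfl fun i _ => by ring
    have e2 : PQ w x' = p * (h' * h') := by
      rw [e1, hx]
      simp only [h', a, b]
      ring
    have e3 : PQ w r = h * h * PQ w y - 2 * h * B + PQ w x := by
      simp only [PQ, B, Finset.mul_sum, ← Finset.sum_add_distrib, ← Finset.sum_sub_distrib]
      refine Finset.sum_congr rfl fun i _ => ?_
      have : r i = x i - h * y i := by rw [hxy i]; ring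
      rw [this]; ring
    have e4 : h * h' = PQ w r := by
      rw [e3, hx]
      simp only [h', a, b]
      ring
    have hr0 : PQ w r ≠ 0 := fun h => hr (PQ_aniso w hw r h)
    have h'0 : h' ≠ 0 := by
      intro h5; rw [h5, mul_zero] at e4; exact hr0 e4.symm
    have hNpos : 0 < N := by
      rcases Nat.eq_zero_or_pos N with h5 | h5
      · exfalso; apply hr
        funext i
        have : (r i).degree < h.degree := EuclideanDomain.mod_lt (x i) h0
        rw [degree_eq_natDegree h0, hN, h5] at this
        simpa using this
      · exact h5
    have hrd : ∀ i, (r i).natDegree ≤ N - 1 := fun i => by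
      have : (r i).degree < h.degree := EuclideanDomain.mod_lt (x i) h0
      rw [degree_eq_natDegree h0, hN] at this
      have h6 : (r i).natDegree < N ∨ r i = 0 := by
        by_cases h7 : r i = 0
        · exact Or.inr h7
        · rw [degree_eq_natDegree h7] at this
          exact Or.inl (by exact_mod_cast this)
      rcases h6 with h6 | h6
      · omega
      · rw [h6]; simp
    have hQd : (PQ w r).natDegree ≤ (N - 1) + (N - 1) := by
      refine natDegree_sum_le_of_forall_le _ _ fun i _ => ?_
      refine (natDegree_C_mul_le _ _).trans (natDegree_mul_le.trans ?_)
      have := hrd i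
      omega
    have hd := natDegree_mul h0 h'0
    rw [e4] at hd
    exact ih h'.natDegree (by omega) h' x' h'0 rfl e2

theorem cassels {n : ℕ} (w : Fin n → K)
    (hw : ∀ x : Fin n → K, ∑ i, w i * (x i * x i) = 0 → x = 0) (p : K[X])
    (x : Fin n → RatFunc K)
    (hx : ∑ i, RatFunc.C (w i) * (x i * x i) = algebraMap K[X] (RatFunc K) p) :
    ∃ y, PQ w y = p := by
  obtain ⟨b, hb⟩ := IsLocalization.exist_integer_multiples_of_finite (nonZeroDivisors K[X]) x
  choose z hz using hb
  refine cassels_poly w hw p _ (b : K[X]) z (nonZeroDivisors.ne_zero b.2) rfl ?_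
  apply IsFractionRing.injective K[X] (RatFunc K)
  rw [PQ, map_sum, map_mul, ← hx, Finset.sum_mul]
  refine Finset.sum_congr rfl fun i _ => ?_
  rw [map_mul, map_mul, hz, RatFunc.algebraMap_C, map_mul, Algebra.smul_def]
  ring

theorem cassels_const {l : List K} (hl : ¬ Iso l) {c : K}
    (h : Rep (l.map (RatFunc.C : K →+* RatFunc K)) (RatFunc.C c)) : Rep l c := by
  have hw : ∀ x : Fin l.length → K, ∑ i, l.get i * (x i * x i) = 0 → x = 0 := fun x hx => by
    by_contra h0; exact hl ((iso_iff l).2 ⟨x, h0, hx⟩)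
  obtain ⟨x, hx⟩ := (rep_map_iff _ _ _).1 h
  rw [← RatFunc.algebraMap_C] at hx
  obtain ⟨y, hy⟩ := cassels l.get hw (C c) x hx
  refine (rep_iff l c).2 ⟨fun i => (y i).coeff 0, ?_⟩
  have := PQ_deg l.get hw y 1 (by rw [hy]; exact lt_of_le_of_lt degree_C_le (by norm_num))
  have h3 := PQ_coeff l.get y 0 fun i => by
    have h4 := this i
    rw [natDegree_le_iff_degree_le]
    exact Order.lt_succ_iff.1 h4
  rw [← h3, hy]; simp

theorem iso_ratfunc {l : List K} (hl : ¬ Iso l) :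
    ¬ Iso (l.map (RatFunc.C : K →+* RatFunc K)) := by
  have hw : ∀ x : Fin l.length → K, ∑ i, l.get i * (x i * x i) = 0 → x = 0 := fun x hx => by
    by_contra h0; exact hl ((iso_iff l).2 ⟨x, h0, hx⟩)
  intro h
  obtain ⟨x, hx0, hx⟩ := (iso_map_iff _ _).1 h
  obtain ⟨b, hb⟩ := IsLocalization.exist_integer_multiples_of_finite (nonZeroDivisors K[X]) x
  choose z hz using hb
  have hz0 : PQ l.get z = 0 := by
    apply IsFractionRing.injective K[X] (RatFunc K)
    rw [PQ, map_sum, map_zero, ← mul_zero (algebraMap K[X] (RatFunc K) (b * b)), ← hx,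
      Finset.mul_sum]
    refine Finset.sum_congr rfl fun i _ => ?_
    rw [map_mul, map_mul, hz, RatFunc.algebraMap_C, map_mul, Algebra.smul_def]
    ring
  have := PQ_aniso l.get hw z hz0
  apply hx0
  funext i
  have h3 := hz i
  rw [this, Algebra.smul_def] at h3
  simp only [Pi.zero_apply, map_zero] at h3
  rcases mul_eq_zero.1 h3.symm with h4 | h4
  · exact absurd ((IsFractionRing.injective K[X] (RatFunc K)) (h4.trans (map_zero _).symm))
      (nonZeroDivisors.ne_zero b.2)
  · exact h4

theorem quad_coeffs {a d A B D : K}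
    (h : (C a * (X * X) + C d : K[X]) = C A * X ^ 2 + C B * X + C D) : A = a ∧ B = 0 ∧ D = d := by
  have c2 := congrArg (fun p => coeff p 2) h
  have c1 := congrArg (fun p => coeff p 1) h
  have c0 := congrArg (fun p => coeff p 0) h
  simp only [← pow_two] at c0 c1 c2
  simp [coeff_C, coeff_X, coeff_X_pow] at c0 c1 c2
  exact ⟨c2.symm, c1.symm, c0.symm⟩

theorem cassels_quad (h2 : (2 : K) ≠ 0) {l : List K} (hnz : NZ l) (hl : ¬ Iso l) {c d : K}
    (hc : c ≠ 0) (hd : d ≠ 0)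
    (h : Rep (l.map (RatFunc.C : K →+* RatFunc K))
      (RatFunc.C c * (RatFunc.X * RatFunc.X) + RatFunc.C d)) :
    ∃ l', NZ l' ∧ LE l (c :: d :: l') := by
  have hw : ∀ x : Fin l.length → K, ∑ i, l.get i * (x i * x i) = 0 → x = 0 := fun x hx => by
    by_contra h0; exact hl ((iso_iff l).2 ⟨x, h0, hx⟩)
  obtain ⟨x, hx⟩ := (rep_map_iff _ _ _).1 h
  have he : RatFunc.C c * (RatFunc.X * RatFunc.X) + RatFunc.C d =
      algebraMap K[X] (RatFunc K) (C c * (X * X) + C d) := by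
    simp [RatFunc.algebraMap_C, RatFunc.algebraMap_X]
  rw [he] at hx
  obtain ⟨y, hy⟩ := cassels l.get hw _ x hx
  have hdeg := PQ_deg l.get hw y 2 (by
    rw [hy]
    refine lt_of_le_of_lt (b := ((2 : ℕ) : WithBot ℕ)) ?_ (by norm_num)
    rw [← natDegree_le_iff_degree_le]
    compute_degree)
  have hy1 : ∀ i, y i = C ((y i).coeff 1) * X + C ((y i).coeff 0) := fun i =>
    eq_X_add_C_of_degree_le_one (Order.lt_succ_iff.1 (hdeg i))
  have hexp : PQ l.get y = C (∑ i, l.get i * ((y i).coeff 1 * (y i).coeff 1)) * (X ^ 2)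
      + C (2 * ∑ i, l.get i * ((y i).coeff 1 * (y i).coeff 0)) * X
      + C (∑ i, l.get i * ((y i).coeff 0 * (y i).coeff 0)) := by
    simp only [PQ, map_sum, map_mul, Finset.mul_sum, Finset.sum_mul, ← Finset.sum_add_distrib]
    refine Finset.sum_congr rfl fun i _ => ?_
    conv_lhs => rw [hy1 i]
    simp only [map_ofNat]
    ring
  rw [hy] at hexp
  obtain ⟨c2, c1, c0⟩ := quad_coeffs hexp
  obtain ⟨l', h3, h4, h5⟩ := orth_split h2 hnz (fun i => (y i).coeff 1) (fun i => (y i).coeff 0)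
    hc c2 c0 ((mul_eq_zero.1 c1).resolve_left h2)
  obtain ⟨l'', h6, h7⟩ := rep_split h3 hd h5
  exact ⟨l'', h6, h4.trans (h7.cons c)⟩

end QF


namespace QF

variable {K : Type} [Field K]

theorem exists_sqrt {a : K} (ha : ∀ s, s * s ≠ a) :
    ∃ (L : Type) (_ : Field L) (f : K →+* L) (s : L), s * s = f a ∧
      (∀ z, ∃ u w, z = f u + f w * s) ∧ ∀ u w, f u + f w * s = 0 → u = 0 ∧ w = 0 := by
  have : Fact (∀ r : K, r ^ 2 ≠ a + 0 * r) := ⟨fun r h => ha r (by rw [← pow_two, h]; ring)⟩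
  refine ⟨QuadraticAlgebra K a 0, inferInstance, algebraMap K _, ⟨0, 1⟩, ?_, ?_, ?_⟩
  · ext <;> simp
  · intro z
    refine ⟨z.re, z.im, ?_⟩
    ext <;> simp
  · intro u w h
    have h1 := congrArg QuadraticAlgebra.re h
    have h3 := congrArg QuadraticAlgebra.im h
    simp at h1 h3
    exact ⟨h1, h3⟩

theorem quad_step (h2 : (2 : K) ≠ 0) {a : K} (ha : a ≠ 0) {L : Type} [Field L] (f : K →+* L) (s : L)
    (hs : s * s = f a) (hg : ∀ z, ∃ u w, z = f u + f w * s)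
    (hi : ∀ u w, f u + f w * s = 0 → u = 0 ∧ w = 0) {l : List K} (hl : NZ l) (hA : ¬ Iso l)
    (h : Iso (l.map f)) : ∃ e l', e ≠ 0 ∧ NZ l' ∧ LE l (e :: (-a * e) :: l') := by
  obtain ⟨z, hz0, hz⟩ := (iso_map_iff f l).1 h
  choose u w huw using fun i => hg (z i)
  have h1 : f ((∑ i, l.get i * (u i * u i)) + a * ∑ i, l.get i * (w i * w i))
      + f (2 * ∑ i, l.get i * (w i * u i)) * s = 0 := by
    rw [← hz]
    simp only [map_add, map_mul, map_sum, Finset.mul_sum, Finset.sum_mul,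
      ← Finset.sum_add_distrib, ← hs]
    refine Finset.sum_congr rfl fun i _ => ?_
    rw [huw i, map_ofNat]
    ring
  obtain ⟨h3, h4⟩ := hi _ _ h1
  have hw0 : w ≠ 0 := by
    rintro rfl
    simp only [Pi.zero_apply, mul_zero, Finset.sum_const_zero, add_zero] at h3
    apply hA
    refine (iso_iff l).2 ⟨u, ?_, h3⟩
    rintro rfl
    apply hz0
    funext i
    rw [huw i]; simp
  have he : ∑ i, l.get i * (w i * w i) ≠ 0 := fun h => hA ((iso_iff l).2 ⟨w, hw0, h⟩)
  obtain ⟨l', h5, h6, h7⟩ := orth_split (e := -a * ∑ i, l.get i * (w i * w i)) h2 hl w u he rfl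
    (by linear_combination h3) ((mul_eq_zero.1 h4).resolve_left h2)
  obtain ⟨l'', h8, h9⟩ := rep_split h5 (mul_ne_zero (neg_ne_zero.2 ha) he) h7
  exact ⟨_, l'', he, h8, h6.trans (h9.cons _)⟩

theorem quad_decomp (h2 : (2 : K) ≠ 0) {a : K} (ha : a ≠ 0) {L : Type} [Field L] (f : K →+* L)
    (s : L) (hs : s * s = f a) (hg : ∀ z, ∃ u w, z = f u + f w * s)
    (hi : ∀ u w, f u + f w * s = 0 → u = 0 ∧ w = 0) (n : ℕ) :
    ∀ (l : List K), l.length = n → NZ l → ¬ Iso l → Hyp' (l.map f) →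
      ∃ τ, NZ τ ∧ LE l (τ ++ sc (-a) τ) := by
  have h2L : (2 : L) ≠ 0 := by
    have := (map_ne_zero f).2 h2
    rwa [map_ofNat] at this
  induction n using Nat.strong_induction_on with
  | _ n ih =>
    intro l hn hl hA hH
    by_cases h0 : l = []
    · subst h0; exact ⟨[], NZ.nil, LE.refl _⟩
    · have hiso : Iso (l.map f) := hH.iso h2L (by simpa using h0)
      obtain ⟨e, l', he, hl', hle⟩ := quad_step h2 ha f s hs hg hi hl hA hiso
      have hA' : ¬ Iso l' := fun h => hA (hle.symm.iso (iso_right (l := [e, -a * e]) h))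
      have hs0 : s ≠ 0 := by
        rintro rfl
        rw [zero_mul] at hs
        exact (map_ne_zero f).2 ha hs.symm
      have hfe := (map_ne_zero f).2 he
      have hp : Hyp' [f e, f (-a * e)] := by
        refine ⟨1, LE.trans ?_ (LE.hyp2 h2L hfe)⟩
        refine LE.cons _ ?_
        have := LE.sq (a := -f e) hs0
        rw [hs] at this
        convert this using 2
        rw [map_mul, map_neg]; ring
      have hst := hle.stable h2 hl (hl'.cons (mul_ne_zero (neg_ne_zero.2 ha) he) |>.cons he) L f
      have hH' : Hyp' (l'.map f) := hp.cancel h2L (Hyp'.of_LE hst.symm hH)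
      have hlen := hle.length
      simp at hlen
      obtain ⟨τ, hτ, hle'⟩ := ih l'.length (by omega) l' rfl hl' hA' hH'
      refine ⟨e :: τ, hτ.cons he, hle.trans (((hle'.cons _).cons _).trans (LE.perm ?_))⟩
      rw [sc_cons, List.cons_append]
      exact List.Perm.cons _ List.perm_middle.symm

theorem swap_aux {V : Type} [AddCommGroup V] [Module K V] (q : QuadraticForm K V) (a : K)
    (x y : V) : q (x + a • y) + -a * q (y + x)
      = (q x + -a * q y) + (q (a • y) + -a * q x) := by
  rw [QuadraticMap.map_add q, QuadraticMap.map_add q, QuadraticMap.polar_smul_right,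
    QuadraticMap.map_smul, QuadraticMap.polar_comm q y x]
  simp only [smul_eq_mul]
  ring

theorem orth_split_V (h2 : (2 : K) ≠ 0) {l : List K} (hl : NZ l) {φ : QF K} (h : φ.Equiv (dg l))
    (x y : φ.V) {d e : K} (hd : d ≠ 0) (hx : φ.q x = d) (hy : φ.q y = e)
    (hxy : φ.q (x + y) = d + e) : ∃ l', NZ l' ∧ LE l (d :: l') ∧ Rep l' e := by
  obtain ⟨E, hE⟩ := h.out
  obtain ⟨l', hl', hle⟩ := rep_split hl hd ⟨E x, (hE x).trans hx⟩
  refine ⟨l', hl', hle, ?_⟩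
  obtain ⟨F, hF⟩ := Equiv.out hle
  have key : ∀ z, (dg (d :: l')).q (F (E z)) = φ.q z := fun z => (hF _).trans (hE z)
  have kx := (key x).trans hx
  have ky := (key y).trans hy
  have kxy := (key (x + y)).trans hxy
  rw [map_add, map_add] at kxy
  obtain ⟨v, hv⟩ := orth_aux h2 hd (dg l').q (F (E x)) (F (E y)) kx (kxy.trans (by
    exact congrArg (d + ·) ky.symm))
  exact ⟨v, hv.trans ky⟩

theorem quad_sub (h2 : (2 : K) ≠ 0) {a : K} (ha : a ≠ 0) {τ : List K} (hτ : NZ τ) {d : K}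
    (hd : d ≠ 0) (h : Rep (τ ++ sc (-a) τ) d) :
    ∃ ψ, NZ ψ ∧ LE (τ ++ sc (-a) τ) (d :: (-a * d) :: ψ) := by
  obtain ⟨u, w, ⟨x, hx⟩, hw, huw⟩ := rep_append.1 h
  obtain ⟨v, ⟨y, hy⟩, rfl⟩ := rep_sc.1 hw
  have hE : (add (dg τ) (smul (-a) (dg τ))).Equiv (dg (τ ++ sc (-a) τ)) :=
    ((dg_append _ _).trans' (add_congr (Equiv.rfl' _) (dg_sc _ _))).symm'
  have hna := neg_ne_zero.2 ha
  have hq1 : (dg τ).q x + -a * (dg τ).q y = d := by rw [hx, hy, huw]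
  have hq2 : (dg τ).q (a • y) + -a * (dg τ).q x = -a * d := by
    rw [QuadraticMap.map_smul, ← hq1]; simp only [smul_eq_mul]; ring
  obtain ⟨l', h3, h4, h5⟩ := orth_split_V h2 (hτ.append (hτ.sc hna)) hE (x, y) (a • y, x)
    (d := d) (e := -a * d) hd hq1 hq2 (by
      refine (swap_aux (dg τ).q a x y).trans ?_
      rw [hq1, hq2])
  obtain ⟨ψ, h6, h7⟩ := rep_split h3 (mul_ne_zero hna hd) h5
  exact ⟨ψ, h6, h4.trans (h7.cons d)⟩

theorem rep_map {L : Type} [Field L] (f : K →+* L) {l : List K} {d : K} (h : Rep l d) :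
    Rep (l.map f) (f d) := by
  obtain ⟨x, rfl⟩ := (rep_iff l d).1 h
  exact (rep_map_iff f l _).2 ⟨fun i => f (x i), by simp only [map_sum, map_mul]⟩

theorem descend (h2 : (2 : K) ≠ 0) (m : List K) (hm : NZ m) :
    ∀ (φ : List K), NZ φ → ¬ Iso φ → ∀ ψ : List (RatFunc K),
      LE (φ.map (RatFunc.C : K →+* RatFunc K)) (m.map (RatFunc.C : K →+* RatFunc K) ++ ψ) →
      ∃ ψ0, NZ ψ0 ∧ LE φ (m ++ ψ0) ∧ LE (ψ0.map (RatFunc.C : K →+* RatFunc K)) ψ := by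
  have h2L : (2 : RatFunc K) ≠ 0 := by
    have := (map_ne_zero (RatFunc.C : K →+* RatFunc K)).2 h2
    rwa [map_ofNat] at this
  induction m with
  | nil => intro φ hφ _ ψ h; exact ⟨φ, hφ, LE.refl _, h⟩
  | cons b m ih =>
    intro φ hφ hA ψ h
    have hb := hm.head
    have h1 : Rep (φ.map (RatFunc.C : K →+* RatFunc K)) (RatFunc.C b) :=
      h.symm.rep (rep_cons.2 ⟨1, 0, rep_zero _, by ring⟩)
    obtain ⟨φ1, h3, h4⟩ := rep_split hφ hb (cassels_const hA h1)
    have h5 := h4.stable h2 hφ (h3.cons hb) _ (RatFunc.C : K →+* RatFunc K)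
    have h6 : LE (φ1.map (RatFunc.C : K →+* RatFunc K))
        (m.map (RatFunc.C : K →+* RatFunc K) ++ ψ) :=
      cancel_one h2L ((map_ne_zero _).2 hb) (h5.symm.trans h)
    obtain ⟨ψ0, h7, h8, h9⟩ := ih hm.tail φ1 h3
      (fun h => hA (h4.symm.iso (iso_right (l := [b]) h))) ψ h6
    exact ⟨ψ0, h7, h4.trans (h8.cons b), h9⟩

theorem subform (n : ℕ) : ∀ (K : Type) [Field K] (_ : (2 : K) ≠ 0) (c : List K), c.length = n →
    NZ c → ∀ φ : List K, NZ φ → ¬ Iso φ → ∀ d : K, d ≠ 0 → Rep φ d →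
    (∀ (L : Type) [Field L] (f : K →+* L), Iso ((1 :: c).map f) → Hyp' (φ.map f)) →
    ∃ ψ, NZ ψ ∧ LE φ (sc d (1 :: c) ++ ψ) := by
  induction n using Nat.strong_induction_on with
  | _ n ih =>
  intro K _ h2 c hn hc φ hφ hA d hd hRep H
  match c, hn, hc, H with
  | [], _, _, _ =>
    simpa using rep_split hφ hd hRep
  | [c1], _, hc, H =>
    have hc1 := hc.head
    by_cases hsq : ∃ s, s * s = -c1
    · exfalso
      obtain ⟨s, hs⟩ := hsq
      have hH : Hyp' φ := by
        simpa using H K (RingHom.id K) (by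
          refine (iso_map_iff _ _).2 ⟨![s, 1], ?_, ?_⟩
          · intro h; exact one_ne_zero (α := K) (congrFun h 1)
          · simp [Fin.sum_univ_two, hs])
      refine hA (hH.iso h2 ?_)
      rintro rfl
      exact hd (rep_nil.1 hRep)
    · push Not at hsq
      obtain ⟨L, _, f, s, hs, hg, hi⟩ := exists_sqrt hsq
      have hH : Hyp' (φ.map f) := H L f (by
        refine (iso_map_iff _ _).2 ⟨![s, 1], ?_, ?_⟩
        · intro h; exact one_ne_zero (α := L) (congrFun h 1)
        · simp [Fin.sum_univ_two, hs])
      obtain ⟨τ, hτ, hle⟩ := quad_decomp h2 (neg_ne_zero.2 hc1) f s hs hg hi _ φ rfl hφ hA hH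
      obtain ⟨ψ, h3, h4⟩ := quad_sub h2 (neg_ne_zero.2 hc1) hτ hd (hle.rep hRep)
      refine ⟨ψ, h3, ?_⟩
      have h5 := hle.trans h4
      simpa [mul_comm] using h5
  | c1 :: c2 :: l, hn, hc, H =>
    have h2L : (2 : RatFunc K) ≠ 0 := by
      have := (map_ne_zero (RatFunc.C : K →+* RatFunc K)).2 h2
      rwa [map_ofNat] at this
    have hc1 := hc.head
    have hc2 := hc.tail.head
    have hl : NZ l := hc.tail.tail
    let F : K →+* RatFunc K := RatFunc.C
    let g : RatFunc K := F c1 * (RatFunc.X * RatFunc.X) + F c2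
    have hg : g ≠ 0 := by
      have he : g = algebraMap (Polynomial K) (RatFunc K)
          (Polynomial.C c1 * (Polynomial.X * Polynomial.X) + Polynomial.C c2) := by
        simp [g, F, RatFunc.algebraMap_C, RatFunc.algebraMap_X]
      rw [he]
      intro h
      have h3 := IsFractionRing.injective (Polynomial K) (RatFunc K) (h.trans (map_zero _).symm)
      have := congrArg (fun p => Polynomial.coeff p 0) h3
      simp at this
      exact hc2 this
    obtain ⟨ψ, hψ, hle⟩ := ih (l.length + 1) (by simp at hn; omega) (RatFunc K) h2L
      (g :: l.map F) (by simp) ((hl.map F).cons hg) (φ.map F) (hφ.map F) (iso_ratfunc hA) (F d)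
      ((map_ne_zero F).2 hd) (rep_map F hRep) (by
        intro L _ f hf
        have h3 := H L (f.comp F) (by
          have hfg := (map_ne_zero f).2 hg
          have h4 : Rep [f (F c1), f (F c2)] (f g) := by
            refine rep_cons.2 ⟨f RatFunc.X, f (F c2), rep_one.2 ⟨1, by ring⟩, ?_⟩
            simp only [g, map_add, map_mul]
          obtain ⟨k, -, hk⟩ := rep_split (NZ.cons ((map_ne_zero f).2 ((map_ne_zero F).2 hc1))
            (NZ.cons ((map_ne_zero f).2 ((map_ne_zero F).2 hc2)) NZ.nil)) hfg h4
          have h5 : LE (((1 :: c1 :: c2 :: l).map (f.comp F)))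
              (k ++ (1 :: g :: l.map F).map f) := by
            have h6 : LE ([f (F c1), f (F c2)] ++ (1 :: l).map (f.comp F))
              ((f g :: k) ++ (1 :: l).map (f.comp F)) := hk.append (LE.refl _)
            refine LE.trans (LE.perm ?_) (h6.trans (LE.perm ?_))
            · simp only [List.map_cons, List.cons_append, List.nil_append, RingHom.comp_apply]
              exact (List.Perm.swap _ _ _).trans ((List.Perm.swap _ _ _).cons _)
            · have : (l.map F).map f = l.map (f.comp F) := by simp
              simp only [List.map_cons, List.cons_append, this, map_one]
              refine List.perm_middle.symm.trans (List.Perm.append_left k ?_)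
              exact List.Perm.swap _ _ _
          exact h5.symm.iso (iso_right hf))
        simpa using h3)
    have hm : NZ (d :: sc d l) := (hl.sc hd).cons hd
    obtain ⟨ψ0, h3, h4, h5⟩ := descend h2 (d :: sc d l) hm φ hφ hA ((F d * g) :: ψ) (by
      refine hle.trans (LE.perm ?_)
      simp only [sc_cons, mul_one, List.cons_append, List.map_cons, sc_map]
      exact List.Perm.cons _ List.perm_middle.symm)
    have hA0 : ¬ Iso ψ0 := fun h => hA (h4.symm.iso (iso_right h))
    have h6 : Rep (ψ0.map F) (F d * g) := h5.symm.rep (rep_cons.2 ⟨1, 0, rep_zero _, by ring⟩)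
    obtain ⟨l', h7, h8⟩ := cassels_quad h2 h3 hA0 (mul_ne_zero hd hc1) (mul_ne_zero hd hc2) (by
      have he : F d * g = RatFunc.C (d * c1) * (RatFunc.X * RatFunc.X) + RatFunc.C (d * c2) := by
        simp only [g, F, map_mul]; ring
      rw [← he]; exact h6)
    refine ⟨l', h7, h4.trans (((LE.refl _).append h8).trans (LE.perm ?_))⟩
    simp only [sc_cons, mul_one, List.cons_append]
    refine List.Perm.cons _ ?_
    exact List.perm_middle.trans (List.Perm.cons _ List.perm_middle)

end QF


namespace QF

/-- sum of scaled Pfister lists -/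
def sp {K : Type} [Field K] : List (K × List K) → List K
  | [] => []
  | p :: P => sc p.1 (pf p.2) ++ sp P

theorem sp_map {K L : Type} [Field K] [Field L] (f : K →+* L) (P : List (K × List K)) :
    (sp P).map f = sp (P.map fun p => (f p.1, p.2.map f)) := by
  induction P with
  | nil => rfl
  | cons p P ih => simp [sp, ih, sc_map, pf_map]

theorem hauptsatz (n r : ℕ) : ∀ (K : Type) [Field K] (_ : (2 : K) ≠ 0) (P : List (K × List K)),
    P.length = r → (∀ p ∈ P, p.2.length = n) → NZ (sp P) → ∀ φ : List K, NZ φ →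
    φ.length < 2 ^ n → Hyp' (φ ++ sp P) → Hyp' φ := by
  induction r with
  | zero =>
    intro K _ h2 P hP hn hnz φ hφ hlen h
    have : P = [] := List.length_eq_zero_iff.1 hP
    subst this
    simpa [sp] using h
  | succ r ih =>
    intro K _ h2 P hP hn hnz φ hφ hlen h
    match P, hP, hn, hnz, h with
    | (c, as) :: P, hP, hn, hnz, h =>
    obtain ⟨m, φ1, hφ1, hA, hle⟩ := witt_decomp h2 hφ
    have hlen1 : φ1.length < 2 ^ n := by
      have := hle.length
      rw [List.length_append] at this
      omega
    suffices h1 : Hyp' φ1 from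
      Hyp'.of_LE hle (Hyp'.append ⟨m, LE.refl _⟩ h1)
    have h1 : Hyp' (φ1 ++ sp ((c, as) :: P)) := by
      have h3 : Hyp' (hypL m ++ (φ1 ++ sp ((c, as) :: P))) := by
        rw [← List.append_assoc]
        exact Hyp'.of_LE (hle.symm.append (LE.refl _)) h
      exact Hyp'.cancel h2 ⟨m, LE.refl _⟩ h3
    have hnz1 : NZ (sc c (pf as)) := NZ.left (l' := sp P) hnz
    have hnzP : NZ (sp P) := NZ.right (l := sc c (pf as)) hnz
    have hpf : NZ (pf as) := hnz1.of_sc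
    obtain ⟨t, ht⟩ := pf_head as
    have hc : c ≠ 0 := by
      rw [ht, sc_cons] at hnz1
      simpa using hnz1.head
    match φ1, hφ1, hA, hlen1, h1 with
    | [], _, _, _, _ => exact ⟨0, LE.refl _⟩
    | d :: φ2, hφ1, hA, hlen1, h1 =>
    exfalso
    obtain ⟨ψ, -, hψ⟩ := subform t.length K h2 t rfl (by rw [ht] at hpf; exact hpf.tail) (d :: φ2)
      hφ1 hA d hφ1.head (rep_cons.2 ⟨1, 0, rep_zero _, by ring⟩) (by
        intro L _ f hf
        have h2L : (2 : L) ≠ 0 := by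
          have := (map_ne_zero f).2 h2
          rwa [map_ofNat] at this
        rw [← ht, pf_map] at hf
        have h3 : Hyp' (pf (as.map f)) := (pf_round h2L _ (by
          rw [← pf_map]; exact hpf.map f)).2 hf
        have h4 := h3.sc h2L ((map_ne_zero f).2 hc)
        have h5 := h1.map h2 (hφ1.append hnz) f
        rw [sp, List.map_append, List.map_append, sc_map, pf_map] at h5
        have h6 : Hyp' ((d :: φ2).map f ++ (sp P).map f) := by
          refine Hyp'.cancel h2L h4 (h5.of_perm ?_)
          rw [← List.append_assoc, ← List.append_assoc]
          exact List.perm_append_comm.append_right _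
        rw [sp_map] at h6
        refine ih L h2L _ (by simpa using hP) ?_ ?_ _ (hφ1.map f) (by simpa using hlen1) h6
        · intro p hp
          obtain ⟨p', hp', rfl⟩ := List.mem_map.1 hp
          simpa using hn p' (by simp [hp'])
        · rw [← sp_map]; exact hnzP.map f)
    have h7 := hψ.length
    rw [← ht, List.length_append, sc_length, pf_length, hn (c, as) (by simp)] at h7
    omega

end QF


open scoped TensorProduct

namespace QF

variable {K : Type} [Field K]

theorem wss_dg (n : ℕ) (w : Fin n → K) :
    ∃ e : (Fin n → K) ≃ₗ[K] (dg (List.ofFn w)).V,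
      ∀ x, (dg (List.ofFn w)).q (e x) = ∑ i, w i * (x i * x i) := by
  induction n with
  | zero =>
    refine ⟨LinearEquiv.refl K (Fin 0 → K), fun x => ?_⟩
    exact (zero_q x).trans (by simp)
  | succ n ih =>
    obtain ⟨e, he⟩ := ih (fun i => w i.succ)
    rw [List.ofFn_succ]
    refine ⟨(Fin.consLinearEquiv K (fun _ : Fin (n + 1) => K)).symm.trans
      (LinearEquiv.prodCongr (LinearEquiv.refl K K) e), fun x => ?_⟩
    refine (dg_cons_q (w 0) (List.ofFn fun i => w i.succ) (x 0) (e (fun i => x i.succ))).trans ?_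
    rw [he]
    exact (Fin.sum_univ_succ (fun i : Fin (n + 1) => w i * (x i * x i))).symm

/-- diagonal form on `Fin n → K` -/
noncomputable def wss (n : ℕ) (w : Fin n → K) : QF K :=
  { V := Fin n → K, q := QuadraticMap.weightedSumSquares K w }

theorem wss_equiv (n : ℕ) (w : Fin n → K) :
    (QF.Equiv (wss n w)
      (dg (List.ofFn w))) := by
  obtain ⟨e, he⟩ := wss_dg n w
  refine Equiv.mk' (φ := wss n w) e ?_
  intro x
  exact (he x).trans (QuadraticMap.weightedSumSquares_apply w x).symm

theorem bin_equiv (a : K) : (bin a).Equiv (dg [1, -a]) := by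
  have := wss_equiv 2 ![(1 : K), -a]
  exact this

theorem one_equiv : (one : QF K).Equiv (dg [1]) := by
  have := wss_equiv 1 (fun _ => (1 : K))
  exact this

theorem hyperbolics_equiv (m : ℕ) : (hyperbolics m : QF K).Equiv (dg (hypL m)) := by
  induction m with
  | zero => exact Equiv.rfl' _
  | succ m ih =>
    exact (add_congr (bin_equiv 1) ih).trans' (dg_append [1, -1] (hypL m)).symm'

theorem Nondeg.diag [Invertible (2 : K)] {φ : QF K} (h : φ.Nondeg) :
    ∃ l, NZ l ∧ φ.Equiv (dg l) := by
  have hs : (QuadraticMap.associated (R := K) φ.q).SeparatingLeft := by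
    intro x hx
    refine h.1 x fun y => ?_
    have h3 := hx y
    rw [← QuadraticMap.two_nsmul_associated K φ.q]
    change (2 • QuadraticMap.associated φ.q) x y = 0
    rw [LinearMap.smul_apply, LinearMap.smul_apply, h3, smul_zero]
  obtain ⟨w, hw⟩ := QuadraticForm.equivalent_weightedSumSquares_units_of_nondegenerate' φ.q hs
  refine ⟨List.ofFn (fun i => (w i : K)), ?_, ?_⟩
  · intro a ha
    obtain ⟨i, rfl⟩ := (List.mem_ofFn' _ _).1 ha
    exact (w i).ne_zero
  · refine Equiv.trans' (ψ := wss _ (fun i => (w i : K))) ?_ (wss_equiv _ _)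
    obtain ⟨e⟩ := hw
    refine Equiv.mk' (ψ := wss _ (fun i => (w i : K))) e.toLinearEquiv ?_
    intro x
    refine Eq.trans ?_ (e.map_app x)
    change QuadraticMap.weightedSumSquares K (fun i => (w i : K)) (e x)
      = QuadraticMap.weightedSumSquares K w (e x)
    rw [QuadraticMap.weightedSumSquares_apply, QuadraticMap.weightedSumSquares_apply]
    rfl

theorem tens_aux [Invertible (2 : K)] {V : Type} [AddCommGroup V] [Module K V]
    (q : QuadraticForm K V) (a : K) :
    ∃ e : (V × V) ≃ₗ[K] ((Fin 2 → K) ⊗[K] V), ∀ x,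
      QuadraticForm.tmul (QuadraticMap.weightedSumSquares K ![(1 : K), -a]) q (e x)
        = q x.1 + -a * q x.2 := by
  let E : (V × V) ≃ₗ[K] ((Fin 2 → K) ⊗[K] V) :=
    (LinearEquiv.finTwoArrow K V).symm.trans
      ((TensorProduct.piScalarRight K K V (Fin 2)).symm.trans (TensorProduct.comm K V (Fin 2 → K)))
  have hE : ∀ x y, E (x, y) = (Pi.single 0 1 : Fin 2 → K) ⊗ₜ[K] x
      + (Pi.single 1 1 : Fin 2 → K) ⊗ₜ[K] y := by
    intro x y
    have h1 : (LinearEquiv.finTwoArrow K V).symm (x, y) = Pi.single 0 x + Pi.single 1 y := by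
      funext i
      fin_cases i <;> simp [LinearEquiv.finTwoArrow]
    simp only [E, LinearEquiv.trans_apply, h1, map_add, TensorProduct.piScalarRight_symm_single,
      TensorProduct.comm_tmul]
  refine ⟨E, fun ⟨x, y⟩ => ?_⟩
  rw [hE]
  set B : QuadraticForm K (Fin 2 → K) := QuadraticMap.weightedSumSquares K ![(1 : K), -a] with hB
  have hB0 : B (Pi.single 0 1) = 1 := by simp [hB, Fin.sum_univ_two]
  have hB1 : B (Pi.single 1 1) = -a := by simp [hB, Fin.sum_univ_two]
  have hB2 : QuadraticMap.associated (R := K) B (Pi.single 0 1) (Pi.single 1 1) = 0 := by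
    rw [QuadraticMap.associated_apply, hB0, hB1]
    simp [hB, Fin.sum_univ_two]
  rw [QuadraticMap.map_add (QuadraticForm.tmul B q), QuadraticForm.tensorDistrib_tmul,
    QuadraticForm.tensorDistrib_tmul, hB0, hB1]
  have hp : QuadraticMap.polar (QuadraticForm.tmul B q) ((Pi.single 0 1 : Fin 2 → K) ⊗ₜ[K] x)
      ((Pi.single 1 1 : Fin 2 → K) ⊗ₜ[K] y) = 0 := by
    rw [← QuadraticMap.polarBilin_apply_apply, ← QuadraticMap.two_nsmul_associated K,
      LinearMap.smul_apply, LinearMap.smul_apply]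
    have : QuadraticMap.associated (R := K) (QuadraticForm.tmul B q)
        ((Pi.single 0 1 : Fin 2 → K) ⊗ₜ[K] x) ((Pi.single 1 1 : Fin 2 → K) ⊗ₜ[K] y) = 0 := by
      rw [QuadraticForm.associated_tmul, LinearMap.BilinForm.tensorDistrib_tmul, hB2]
      simp
    exact (congrArg (2 • ·) this).trans (smul_zero _)
  rw [hp]
  simp only [smul_eq_mul]
  ring

theorem tmul_bin_equiv [Invertible (2 : K)] (a : K) (φ : QF K) :
    (add φ (smul (-a) φ)).Equiv (tmul (bin a) φ) := by
  obtain ⟨e, he⟩ := tens_aux φ.q a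
  exact Equiv.mk' (φ := add φ (smul (-a) φ)) (ψ := tmul (bin a) φ) e he

theorem pfister_equiv [Invertible (2 : K)] (l : List K) : (pfister l).Equiv (dg (pf l)) := by
  induction l with
  | nil => exact one_equiv
  | cons a l ih =>
    refine (tmul_bin_equiv a (pfister l)).symm'.trans' ?_
    exact ((add_congr ih (smul_congr _ ih)).trans' (add_congr (Equiv.rfl' _) (dg_sc _ _).symm')).trans'
      (dg_append _ _).symm'

theorem sumList_equiv [Invertible (2 : K)] (P : List (K × List K)) :
    (sumList (P.map fun p => smul p.1 (pfister p.2))).Equiv (dg (sp P)) := by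
  induction P with
  | nil => exact Equiv.rfl' _
  | cons p P ih =>
    exact (add_congr ((smul_congr _ (pfister_equiv _)).trans' (dg_sc _ _).symm') ih).trans'
      (dg_append _ _).symm'

theorem LE.nz (h2 : (2 : K) ≠ 0) (n : ℕ) : ∀ (l l' : List K), l.length = n → LE l l' → NZ l' →
    NZ l := by
  induction n with
  | zero =>
    intro l l' hn _ _
    rw [List.length_eq_zero_iff.1 hn]; exact NZ.nil
  | succ n ih =>
    intro l l' hn h hl'
    by_cases hb : ∃ b ∈ l, b ≠ 0
    · obtain ⟨b, hb, hb0⟩ := hb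
      obtain ⟨s, t, rfl⟩ := List.append_of_mem hb
      have hp : (s ++ b :: t).Perm (b :: (s ++ t)) := List.perm_middle
      have h1 : LE (b :: (s ++ t)) l' := (LE.perm hp.symm).trans h
      obtain ⟨l'', h3, h4⟩ := rep_split hl' hb0 (h1.rep (rep_cons.2 ⟨1, 0, rep_zero _, by ring⟩))
      have h5 := ih (s ++ t) l'' (by simp at hn ⊢; omega) (cancel_one h2 hb0 (h1.trans h4)) h3
      exact fun x hx => (h5.cons hb0) x (hp.mem_iff.1 hx)
    · push Not at hb
      exfalso
      have hlen := h.length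
      match l', hl', h, hlen with
      | [], _, _, hlen => simp at hlen; subst hlen; simp at hn
      | c :: l', hl', h, _ =>
        obtain ⟨x, hx⟩ := (rep_iff l c).1 (h.symm.rep (rep_cons.2 ⟨1, 0, rep_zero _, by ring⟩))
        apply hl'.head
        rw [← hx]
        refine Finset.sum_eq_zero fun i _ => ?_
        rw [hb _ (List.get_mem l i), zero_mul]

theorem sp_perm (a : K) (P : List (K × List K)) :
    (sp (P.map fun p => (p.1, a :: p.2))).Perm (sp P ++ sc (-a) (sp P)) := by
  induction P with
  | nil => exact List.Perm.refl _
  | cons p P ih =>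
    simp only [sp, List.map_cons, pf, sc_append, sc_sc, mul_comm p.1 (-a)]
    refine (List.Perm.append_left _ ih).trans ?_
    rw [List.append_assoc, List.append_assoc]
    refine List.Perm.append_left _ ?_
    rw [← List.append_assoc, ← List.append_assoc]
    exact List.Perm.append_right _ List.perm_append_comm

theorem main_lists (h2 : (2 : K) ≠ 0) (m : ℕ) {p r : List K} (hp : NZ p) (hr : NZ r)
    (P : List (K × List K)) (hP : ∀ x ∈ P, x.2.length = m + 1) (hlen : p.length < 2 ^ (m + 1))
    (hH : Hyp' (r ++ sc (-1) (sp P))) {a : K} (ha : a ≠ 0)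
    (h : LE (sc a (p ++ r)) (p ++ r)) : LE (sc a p) p ∧ LE (sc a r) r := by
  have hS : NZ (sp P) := by
    obtain ⟨k, hk⟩ := hH
    exact (LE.nz h2 _ _ _ rfl hk (hypL_nz k)).right.of_sc
  have hna := neg_ne_zero.2 ha
  have H1 : Hyp' ((p ++ r) ++ sc (-a) (p ++ r)) :=
    Hyp'.of_LE (h.symm.append (LE.refl _)) (Hyp'.neg' h2 (hp.append hr) a ha)
  have H2 : Hyp' (sc (-1) r ++ sp P) := by
    have := hH.sc h2 (a := -1) (by simp)
    simpa using this
  have H3 : Hyp' (sc a r ++ sc (-a) (sp P)) := by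
    have := hH.sc h2 ha
    simpa using this
  have H4 : Hyp' (r ++ sc (-1) r) := Hyp'.neg h2 hr
  have H5 : Hyp' (sc a r ++ sc (-a) r) := Hyp'.neg' h2 hr a ha
  have hperm := sp_perm a P
  have H6 : Hyp' ((p ++ sc (-a) p) ++ sp (P.map fun x => (x.1, a :: x.2))) := by
    refine Hyp'.cancel h2 (H4.append H5) (((H1.append H2).append H3).of_perm ?_)
    refine (List.Perm.append_left _ (List.Perm.append_left _ hperm)).trans ?_
    rw [← Multiset.coe_eq_coe]
    simp only [← Multiset.coe_add, sc_append]
    abel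
  have H7 : Hyp' (p ++ sc (-a) p) := by
    refine hauptsatz (m + 2) _ K h2 _ rfl ?_ ?_ _ (hp.append (hp.sc hna)) ?_ H6
    · intro x hx
      obtain ⟨y, hy, rfl⟩ := List.mem_map.1 hx
      simp [hP y hy]
    · exact fun x hx => (hS.append (hS.sc hna)) x (hperm.mem_iff.1 hx)
    · rw [List.length_append, sc_length, pow_succ]; omega
  have hap : LE (sc a p) p := by
    obtain ⟨i, hi⟩ := H7
    obtain ⟨j, hj⟩ := Hyp'.neg' h2 hp a ha
    have h3 := hi.length
    have h4 := hj.length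
    rw [hypL_length, List.length_append, sc_length] at h3 h4
    rw [sc_length] at h4
    have : i = j := by omega
    subst this
    exact LE.cancel_right h2 (hp.sc hna) (hj.trans hi.symm)
  refine ⟨hap, LE.cancel h2 hp (LE.trans ?_ h)⟩
  rw [sc_append]
  exact hap.symm.append (LE.refl _)

end QF

/-- if `dim π < 2^{m+1}` and `ρ ∈ I^{m+1}K` then `G(π ⊥ ρ) = G(π) ∩ G(ρ)`. -/
theorem stmt4 (K : Type) [Field K] [Invertible (2 : K)] (m : ℕ)
    (π ρ : QF K) (hπ : π.Nondeg) (hρ : ρ.Nondeg)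
    (hdim : π.dim < 2 ^ (m + 1)) (hI : QF.InFundPow (m + 1) ρ) :
    QF.G (QF.add π ρ) = QF.G π ∩ QF.G ρ := by
  have h2 : (2 : K) ≠ 0 := Invertible.ne_zero 2
  ext a
  constructor
  · rintro ⟨ha, h⟩
    obtain ⟨p, hp, hpe⟩ := hπ.diag
    obtain ⟨r, hr, hre⟩ := hρ.diag
    obtain ⟨k, c, l, hc, j, hj⟩ := hI
    have hlist : (List.finRange k).map
        (fun i => QF.smul (c i) (QF.pfister (List.ofFn (l i)))) =
        ((List.finRange k).map fun i => (c i, List.ofFn (l i))).map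
          fun x => QF.smul x.1 (QF.pfister x.2) := by
      rw [List.map_map]; rfl
    rw [hlist] at hj
    set P : List (K × List K) := (List.finRange k).map fun i => (c i, List.ofFn (l i)) with hPdef
    have hP : ∀ x ∈ P, x.2.length = m + 1 := by
      intro x hx
      obtain ⟨i, -, rfl⟩ := List.mem_map.1 hx
      simp
    have hH : QF.Hyp' (r ++ QF.sc (-1) (QF.sp P)) := by
      refine ⟨j, ?_⟩
      have h3 : (QF.dg (r ++ QF.sc (-1) (QF.sp P))).Equiv
          (QF.add ρ (QF.smul (-1) (QF.sumList (P.map fun x => QF.smul x.1 (QF.pfister x.2))))) :=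
        (QF.dg_append _ _).trans' (QF.add_congr hre.symm'
          ((QF.dg_sc _ _).trans' (QF.smul_congr _ (QF.sumList_equiv P).symm')))
      exact h3.trans' (hj.trans' (QF.hyperbolics_equiv j))
    have hlen : p.length < 2 ^ (m + 1) := by
      obtain ⟨e, -⟩ := hpe.out
      rw [← QF.dg_finrank p, ← e.finrank_eq]
      exact hdim
    have hpr : (QF.add π ρ).Equiv (QF.dg (p ++ r)) :=
      (QF.add_congr hpe hre).trans' (QF.dg_append _ _).symm'
    have hLE : QF.LE (QF.sc a (p ++ r)) (p ++ r) :=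
      (QF.dg_sc _ _).trans' ((QF.smul_congr a hpr.symm').trans' (h.trans' hpr))
    obtain ⟨h3, h4⟩ := QF.main_lists h2 m hp hr P hP hlen hH ha hLE
    refine ⟨⟨ha, ?_⟩, ⟨ha, ?_⟩⟩
    · exact (QF.smul_congr a hpe).trans' ((QF.dg_sc _ _).symm'.trans' (h3.trans' hpe.symm'))
    · exact (QF.smul_congr a hre).trans' ((QF.dg_sc _ _).symm'.trans' (h4.trans' hre.symm'))
  · rintro ⟨⟨ha, h1⟩, ⟨-, h3⟩⟩
    exact ⟨ha, (QF.smul_add a π ρ).trans' (QF.add_congr h1 h3)⟩
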